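/- Negligibility of the cross term in the contradiction equation (Lemma A.11). Under the random features setup and the data, activation, and scaling assumptions with n = 2: for every η > 0 there exist constants c, ε₀ > 0 and D such that for all d ≥ D, with probability at least 1 − 2 exp(−c log² d) over V and the data (x_1, x_2), the following holds simultaneously for all real numbers a_1, a_2 and all ε_1, ε_2 ∈ ℝ^d satisfying ‖x_1 + ε_1‖_2 = ‖x_1 + ε_2‖_2 = √d, max(‖ε_1‖_2, ‖ε_2‖_2) ≤ ε₀ √d, and φ(x_2) = a_1 φ(x_1 + ε_1) + a_2 φ(x_1 + ε_2): | a_2 · φ̃(x_2)ᵀ ( φ(x_1 + ε_2) − φ(x_1 + ε_1) ) | ≤ η p. -/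

import Mathlib

open MeasureTheory ProbabilityTheory Filter

noncomputable section

/-- Euclidean (ℓ²) norm of a vector in `Fin m → ℝ`. -/
def eNorm {m : ℕ} (x : Fin m → ℝ) : ℝ := Real.sqrt (∑ j, (x j) ^ 2)

/-- Euclidean dot product. -/
def dotp {m : ℕ} (u v : Fin m → ℝ) : ℝ := ∑ j, u j * v j

/-- The random-features map `x ↦ (φ(vₖᵀx))ₖ`, where `vₖ` is the `k`-th row of `V`. -/
def featureMap {p d : ℕ} (φ : ℝ → ℝ) (V : Fin p → Fin d → ℝ) (x : Fin d → ℝ) :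
    Fin p → ℝ := fun k => φ (dotp (V k) x)

/-- The `l`-th normalized probabilists' Hermite polynomial (orthonormal in `L²(N(0,1))`). -/
def hermiteFn (l : ℕ) (x : ℝ) : ℝ :=
  (Polynomial.aeval x (Polynomial.hermite l)) / Real.sqrt (Nat.factorial l)

/-- The `l`-th Hermite coefficient `μ_l` of `φ`. -/
def hermiteCoeff (φ : ℝ → ℝ) (l : ℕ) : ℝ :=
  ∫ g, φ g * hermiteFn l g ∂(gaussianReal 0 1)

/-- The nonlinear part of the feature map: `φ̃(x) = (φ(vₖᵀx) − μ₁ vₖᵀx)ₖ`. -/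
def tfeatureMap {p d : ℕ} (φ : ℝ → ℝ) (V : Fin p → Fin d → ℝ) (x : Fin d → ℝ) :
    Fin p → ℝ := fun k => φ (dotp (V k) x) - hermiteCoeff φ 1 * dotp (V k) x

/-- `μ̃² := Σ_{l ≥ 3} μ_l²`. -/
def tmu2 (φ : ℝ → ℝ) : ℝ := ∑' l : ℕ, if 3 ≤ l then (hermiteCoeff φ l) ^ 2 else 0

/-- The law of the random features matrix: i.i.d. entries `N(0, 1/d)`. -/
def gaussianMatrix (p d : ℕ) : Measure (Fin p → Fin d → ℝ) :=
  Measure.pi fun _ => Measure.pi fun _ => gaussianReal 0 ((d : NNReal))⁻¹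

/-- Sub-Gaussian norm of a distribution on `ℝ^d`:
`sup_{‖u‖₂ = 1} inf { t > 0 : E exp((uᵀx)²/t²) ≤ 2 }`. -/
def vecSubGNorm {d : ℕ} (P : Measure (Fin d → ℝ)) : ℝ :=
  ⨆ u : {u : Fin d → ℝ // eNorm u = 1},
    sInf {t : ℝ | 0 < t ∧ ∫ x, Real.exp ((dotp u.1 x) ^ 2 / t ^ 2) ∂P ≤ 2}

/-- Data assumption: `P` is a probability distribution on `ℝ^d` with `‖x‖₂ = √d` a.s.
and sub-Gaussian norm at most `K`. -/
structure DataAssumption {d : ℕ} (P : Measure (Fin d → ℝ)) (K : ℝ) : Prop where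
  prob : IsProbabilityMeasure P
  norm_eq : ∀ᵐ x ∂P, eNorm x = Real.sqrt d
  subg : vecSubGNorm P ≤ K

/-- Core activation assumption: `φ` is non-linear, Lipschitz, with Lipschitz derivative,
`μ₀ = μ₂ = 0` and `μ₁ ≠ 0`. -/
structure ActivationAssumptionCore (φ : ℝ → ℝ) : Prop where
  nonlinear : ¬ ∃ a b : ℝ, ∀ z, φ z = a * z + b
  lipschitz : ∃ L : NNReal, LipschitzWith L φ
  differentiable : Differentiable ℝ φ
  deriv_lipschitz : ∃ L' : NNReal, LipschitzWith L' (deriv φ)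
  mu0 : hermiteCoeff φ 0 = 0
  mu2 : hermiteCoeff φ 2 = 0
  mu1 : hermiteCoeff φ 1 ≠ 0

/-- Full activation assumption: additionally, there are two non-zero Hermite coefficients
of order ≥ 3 with different parity. -/
structure ActivationAssumption (φ : ℝ → ℝ) extends ActivationAssumptionCore φ : Prop where
  parity : ∃ l l' : ℕ, 3 ≤ l ∧ 3 ≤ l' ∧ l % 2 ≠ l' % 2 ∧
    hermiteCoeff φ l ≠ 0 ∧ hermiteCoeff φ l' ≠ 0


/-! ## Part 1: elementary vector lemmas -/

lemma eNorm_eq_norm {m : ℕ} (x : Fin m → ℝ) : eNorm x = ‖WithLp.toLp 2 x‖ := by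
  simp [eNorm, EuclideanSpace.norm_eq]

lemma eNorm_nonneg {m : ℕ} (x : Fin m → ℝ) : 0 ≤ eNorm x := Real.sqrt_nonneg _

lemma eNorm_sq {m : ℕ} (x : Fin m → ℝ) : eNorm x ^ 2 = ∑ j, (x j) ^ 2 :=
  Real.sq_sqrt (Finset.sum_nonneg fun _ _ => sq_nonneg _)

lemma eNorm_sq' {m : ℕ} (x : Fin m → ℝ) : eNorm x ^ 2 = dotp x x := by
  rw [eNorm_sq]; simp [dotp, sq]

lemma eNorm_add_le {m : ℕ} (x y : Fin m → ℝ) : eNorm (x + y) ≤ eNorm x + eNorm y := by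
  simp only [eNorm_eq_norm, WithLp.toLp_add]; exact norm_add_le _ _

lemma eNorm_sub_le {m : ℕ} (x y : Fin m → ℝ) : eNorm (x - y) ≤ eNorm x + eNorm y := by
  simp only [eNorm_eq_norm, WithLp.toLp_sub]; exact norm_sub_le _ _

lemma eNorm_smul {m : ℕ} (a : ℝ) (x : Fin m → ℝ) : eNorm (a • x) = |a| * eNorm x := by
  simp only [eNorm_eq_norm, WithLp.toLp_smul, norm_smul, Real.norm_eq_abs]

lemma eNorm_neg {m : ℕ} (x : Fin m → ℝ) : eNorm (-x) = eNorm x := by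
  simp [eNorm]

lemma eNorm_mono {m : ℕ} {x y : Fin m → ℝ} (h : ∀ k, |x k| ≤ y k) : eNorm x ≤ eNorm y := by
  unfold eNorm
  apply Real.sqrt_le_sqrt
  apply Finset.sum_le_sum
  intro k _
  rw [← sq_abs (x k)]
  exact pow_le_pow_left₀ (abs_nonneg _) (h k) 2

lemma eNorm_abs {m : ℕ} (x : Fin m → ℝ) : eNorm (fun k => |x k|) = eNorm x := by
  simp [eNorm]

lemma abs_dotp_le {m : ℕ} (x y : Fin m → ℝ) : |dotp x y| ≤ eNorm x * eNorm y := by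
  have h := Finset.sum_mul_sq_le_sq_mul_sq Finset.univ x y
  rw [← eNorm_sq, ← eNorm_sq, ← mul_pow] at h
  exact abs_le_of_sq_le_sq h (mul_nonneg (eNorm_nonneg _) (eNorm_nonneg _))

lemma dotp_comm {m : ℕ} (x y : Fin m → ℝ) : dotp x y = dotp y x := by
  simp [dotp, mul_comm]

lemma dotp_add {m : ℕ} (x y z : Fin m → ℝ) : dotp x (y + z) = dotp x y + dotp x z := by
  simp [dotp, mul_add, Finset.sum_add_distrib]

lemma dotp_sub {m : ℕ} (x y z : Fin m → ℝ) : dotp x (y - z) = dotp x y - dotp x z := by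
  simp [dotp, mul_sub, Finset.sum_sub_distrib]

lemma dotp_smul {m : ℕ} (a : ℝ) (x y : Fin m → ℝ) : dotp x (a • y) = a * dotp x y := by
  simp only [dotp, Pi.smul_apply, smul_eq_mul, Finset.mul_sum]
  exact Finset.sum_congr rfl fun _ _ => by ring

lemma add_dotp {m : ℕ} (x y z : Fin m → ℝ) : dotp (x + y) z = dotp x z + dotp y z := by
  simp [dotp, add_mul, Finset.sum_add_distrib]

lemma sub_dotp {m : ℕ} (x y z : Fin m → ℝ) : dotp (x - y) z = dotp x z - dotp y z := by
  simp [dotp, sub_mul, Finset.sum_sub_distrib]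

lemma smul_dotp {m : ℕ} (a : ℝ) (x y : Fin m → ℝ) : dotp (a • x) y = a * dotp x y := by
  rw [dotp_comm, dotp_smul, dotp_comm]

/-- The linear features `Vu`. -/
def lf {p d : ℕ} (V : Fin p → Fin d → ℝ) (u : Fin d → ℝ) : Fin p → ℝ := fun k => dotp (V k) u

lemma lf_add {p d : ℕ} (V : Fin p → Fin d → ℝ) (u w : Fin d → ℝ) :
    lf V (u + w) = lf V u + lf V w := by
  funext k; simp [lf, dotp_add]

lemma lf_sub {p d : ℕ} (V : Fin p → Fin d → ℝ) (u w : Fin d → ℝ) :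
    lf V (u - w) = lf V u - lf V w := by
  funext k; simp [lf, dotp_sub]

lemma lf_smul {p d : ℕ} (V : Fin p → Fin d → ℝ) (a : ℝ) (u : Fin d → ℝ) :
    lf V (a • u) = a • lf V u := by
  funext k; simp [lf, dotp_smul]

/-- Smoothness package for `φ`. -/
structure Smooth (φ : ℝ → ℝ) (L : ℝ) : Prop where
  pos : 0 < L
  diff : Differentiable ℝ φ
  lip : ∀ a b, |φ a - φ b| ≤ L * |a - b|
  bd : ∀ a, |deriv φ a| ≤ L
  dlip : ∀ a b, |deriv φ a - deriv φ b| ≤ L * |a - b|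

lemma Smooth.of_act {φ : ℝ → ℝ} (h : ActivationAssumptionCore φ) : ∃ L, Smooth φ L := by
  obtain ⟨L1, h1⟩ := h.lipschitz
  obtain ⟨L2, h2⟩ := h.deriv_lipschitz
  have e1 : (L1 : ℝ) ≤ L1 + L2 + 1 := by have := L2.2; linarith [L2.coe_nonneg]
  have e2 : (L2 : ℝ) ≤ L1 + L2 + 1 := by linarith [L1.coe_nonneg]
  refine ⟨L1 + L2 + 1, by positivity, h.differentiable, fun a b => ?_, fun a => ?_, fun a b => ?_⟩
  · have := h1.dist_le_mul a b
    rw [Real.dist_eq, Real.dist_eq] at this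
    exact this.trans (mul_le_mul_of_nonneg_right e1 (abs_nonneg _))
  · have := norm_deriv_le_of_lipschitz (x₀ := a) h1
    rw [Real.norm_eq_abs] at this
    exact this.trans e1
  · have := h2.dist_le_mul a b
    rw [Real.dist_eq, Real.dist_eq] at this
    exact this.trans (mul_le_mul_of_nonneg_right e2 (abs_nonneg _))

lemma Smooth.lin {φ : ℝ → ℝ} {L : ℝ} (h : Smooth φ L) (x a b : ℝ) :
    |φ b - φ a - deriv φ x * (b - a)| ≤ L * |b - a| * min 2 (|a - x| + |b - x|) := by
  have key : ∃ ξ ∈ Set.uIcc a b, φ b - φ a = deriv φ ξ * (b - a) := by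
    rcases lt_trichotomy a b with hab | hab | hab
    · obtain ⟨c, hc, e⟩ := exists_deriv_eq_slope φ hab h.diff.continuous.continuousOn
        h.diff.differentiableOn
      refine ⟨c, Set.Ioo_subset_Icc_self.trans Set.Icc_subset_uIcc hc, ?_⟩
      rw [e, div_mul_cancel₀ _ (sub_ne_zero.2 hab.ne')]
    · exact ⟨a, Set.left_mem_uIcc, by simp [hab]⟩
    · obtain ⟨c, hc, e⟩ := exists_deriv_eq_slope φ hab h.diff.continuous.continuousOn
        h.diff.differentiableOn
      refine ⟨c, Set.Ioo_subset_Icc_self.trans Set.Icc_subset_uIcc' hc, ?_⟩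
      rw [e]
      have : a - b ≠ 0 := sub_ne_zero.2 hab.ne'
      field_simp
      ring
  obtain ⟨ξ, hξ, e⟩ := key
  rw [e, ← sub_mul, abs_mul, mul_comm (L * |b - a|), ← mul_assoc]
  refine mul_le_mul_of_nonneg_right ?_ (abs_nonneg _)
  rw [mul_comm, mul_min_of_nonneg _ _ h.pos.le]
  refine le_min ?_ ?_
  · calc _ ≤ |deriv φ ξ| + |deriv φ x| := abs_sub _ _
      _ ≤ _ := by linarith [h.bd ξ, h.bd x]
  · refine (h.dlip _ _).trans (mul_le_mul_of_nonneg_left ?_ h.pos.le)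
    rcases Set.mem_uIcc.1 hξ with ⟨h1, h2⟩ | ⟨h1, h2⟩ <;>
    · rcases abs_cases (a - x) with ⟨e1, _⟩ | ⟨e1, _⟩ <;> rcases abs_cases (b - x) with ⟨e2, _⟩ | ⟨e2, _⟩ <;>
        rw [e1, e2, abs_le] <;> constructor <;> linarith


/-! ## Part 2: the deterministic argument -/

/-- The linearized features `ψ(Vz) ⊙ Vu`. -/
def gf {p d : ℕ} (φ : ℝ → ℝ) (V : Fin p → Fin d → ℝ) (z u : Fin d → ℝ) : Fin p → ℝ :=
  fun k => deriv φ (dotp (V k) z) * dotp (V k) u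

structure Good {p d : ℕ} (φ : ℝ → ℝ) (V : Fin p → Fin d → ℝ) (z₁ z₂ : Fin d → ℝ)
    (A M δ c₀ c₁ κ q s : ℝ) : Prop where
  hA : ∀ u, eNorm (lf V u) ≤ A * q * (eNorm u / s)
  hB : ∀ u, eNorm u ≤ s → eNorm (fun k => max (|lf V u k| - M) 0) ≤ δ * q
  hC : c₀ * q ^ 2 ≤ eNorm (featureMap φ V z₁) ^ 2
  hD : ∀ u, c₁ * q ^ 2 * (eNorm u / s) ^ 2 ≤ eNorm (gf φ V z₁ u) ^ 2
  hE : ∀ u, |dotp (featureMap φ V z₁) (gf φ V z₁ u) - κ * q ^ 2 * (dotp z₁ u / s ^ 2)|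
    ≤ δ * q ^ 2 * (eNorm u / s)
  hF : ∀ u, |dotp (tfeatureMap φ V z₂) (gf φ V z₁ u)| ≤ δ * q ^ 2 * (eNorm u / s)

lemma featureMap_norm_le {p d : ℕ} {φ : ℝ → ℝ} {L : ℝ} (h : Smooth φ L)
    (V : Fin p → Fin d → ℝ) (z : Fin d → ℝ) {q B : ℝ} (hq : q = Real.sqrt p)
    (hz : eNorm (lf V z) ≤ B * q) : eNorm (featureMap φ V z) ≤ (|φ 0| + L * B) * q := by
  have h1 : eNorm (featureMap φ V z) ≤ eNorm ((fun _ => |φ 0|) + L • fun k => |lf V z k|) := by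
    apply eNorm_mono
    intro k
    have := h.lip (dotp (V k) z) 0
    simp only [featureMap, Pi.add_apply, Pi.smul_apply, smul_eq_mul, lf]
    rw [sub_zero] at this
    calc _ = |φ 0 + (φ (dotp (V k) z) - φ 0)| := by congr 1; ring
      _ ≤ _ := (abs_add_le _ _).trans (by linarith)
  have h2 : eNorm (fun _ : Fin p => |φ 0|) = |φ 0| * q := by
    simp [eNorm, hq]
    rw [mul_comm, Real.sqrt_sq_eq_abs]
  refine h1.trans ((eNorm_add_le _ _).trans ?_)
  rw [h2, eNorm_smul, eNorm_abs, abs_of_pos h.pos]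
  have := mul_le_mul_of_nonneg_left hz h.pos.le
  linarith

lemma tfeatureMap_norm_le {p d : ℕ} {φ : ℝ → ℝ} {L : ℝ} (h : Smooth φ L)
    (V : Fin p → Fin d → ℝ) (z : Fin d → ℝ) {q B : ℝ} (hq : q = Real.sqrt p)
    (hz : eNorm (lf V z) ≤ B * q) :
    eNorm (tfeatureMap φ V z) ≤ (|φ 0| + L * B + |hermiteCoeff φ 1| * B) * q := by
  have e : tfeatureMap φ V z = featureMap φ V z - hermiteCoeff φ 1 • lf V z := by
    funext k; simp [tfeatureMap, featureMap, lf]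
  rw [e]
  refine (eNorm_sub_le _ _).trans ?_
  rw [eNorm_smul]
  have := featureMap_norm_le h V z hq hz
  have := mul_le_mul_of_nonneg_left hz (abs_nonneg (hermiteCoeff φ 1))
  linarith

lemma featureMap_sub_norm_le {p d : ℕ} {φ : ℝ → ℝ} {L : ℝ} (h : Smooth φ L)
    (V : Fin p → Fin d → ℝ) (y z : Fin d → ℝ) :
    eNorm (featureMap φ V y - featureMap φ V z) ≤ L * eNorm (lf V (y - z)) := by
  rw [← eNorm_abs (lf V (y - z)), ← abs_of_pos h.pos, ← eNorm_smul]
  apply eNorm_mono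
  intro k
  simp only [featureMap, Pi.sub_apply, Pi.smul_apply, smul_eq_mul, lf_sub]
  exact h.lip _ _

lemma gf_norm_le {p d : ℕ} {φ : ℝ → ℝ} {L : ℝ} (h : Smooth φ L)
    (V : Fin p → Fin d → ℝ) (z u : Fin d → ℝ) :
    eNorm (gf φ V z u) ≤ L * eNorm (lf V u) := by
  rw [← eNorm_abs (lf V u), ← abs_of_pos h.pos, ← eNorm_smul]
  apply eNorm_mono
  intro k
  simp only [gf, Pi.smul_apply, smul_eq_mul, lf, abs_mul]
  exact mul_le_mul_of_nonneg_right (h.bd _) (abs_nonneg _)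

lemma rem_norm_le {p d : ℕ} {φ : ℝ → ℝ} {L : ℝ} (h : Smooth φ L)
    {V : Fin p → Fin d → ℝ} {z₁ z₂ : Fin d → ℝ} {A M δ c₀ c₁ κ q s e : ℝ}
    (G : Good φ V z₁ z₂ A M δ c₀ c₁ κ q s) (hA0 : 0 ≤ A) (hM : 0 ≤ M) (hq : 0 ≤ q)
    (hs : 0 < s) {y₁ y₂ : Fin d → ℝ} (h1 : eNorm (y₁ - z₁) ≤ e * s)
    (h2 : eNorm (y₂ - z₁) ≤ e * s) :
    eNorm (featureMap φ V y₂ - featureMap φ V y₁ - gf φ V z₁ (y₂ - y₁)) ≤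
      L * (2 * A * M * e + 2 * δ) * q * (eNorm (y₂ - y₁) / s) := by
  set u := y₂ - y₁ with hu
  set r := eNorm u / s with hr
  have hr0 : 0 ≤ r := div_nonneg (eNorm_nonneg _) hs.le
  have hLV : ∀ k, lf V u k = lf V y₂ k - lf V y₁ k := fun k => by rw [hu, lf_sub]; rfl
  -- pick the normalized direction
  obtain ⟨u', hu', hn⟩ : ∃ u' : Fin d → ℝ, u = r • u' ∧ eNorm u' ≤ s := by
    by_cases h0 : r = 0
    · have : eNorm u = 0 := by
        rcases div_eq_zero_iff.1 h0 with h' | h'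
        · exact h'
        · exact absurd h' hs.ne'
      refine ⟨0, ?_, by simp [eNorm, hs.le]⟩
      rw [eNorm_eq_norm, norm_eq_zero] at this
      simpa using this
    · refine ⟨r⁻¹ • u, by rw [smul_smul, mul_inv_cancel₀ h0, one_smul], ?_⟩
      rw [eNorm_smul, abs_of_nonneg (inv_nonneg.2 hr0)]
      have : eNorm u = r * s := by rw [hr]; field_simp
      rw [this, ← mul_assoc, inv_mul_cancel₀ h0, one_mul]
  set t : Fin p → ℝ := (fun k => |lf V (y₁ - z₁) k|) + (fun k => |lf V (y₂ - z₁) k|) with ht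
  set hh : Fin p → ℝ := fun k => max (|lf V u' k| - M) 0 with hhh
  have b1 : eNorm t ≤ 2 * A * q * e := by
    rw [ht]
    refine (eNorm_add_le _ _).trans ?_
    rw [eNorm_abs, eNorm_abs]
    have i1 := G.hA (y₁ - z₁)
    have i2 := G.hA (y₂ - z₁)
    have j1 : A * q * (eNorm (y₁ - z₁) / s) ≤ A * q * e :=
      mul_le_mul_of_nonneg_left ((div_le_iff₀ hs).2 h1) (mul_nonneg hA0 hq)
    have j2 : A * q * (eNorm (y₂ - z₁) / s) ≤ A * q * e :=
      mul_le_mul_of_nonneg_left ((div_le_iff₀ hs).2 h2) (mul_nonneg hA0 hq)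
    linarith
  have b2 : eNorm hh ≤ δ * q := G.hB u' hn
  have main : eNorm (featureMap φ V y₂ - featureMap φ V y₁ - gf φ V z₁ u) ≤
      eNorm ((L * r) • (M • t + (2 : ℝ) • hh)) := by
    apply eNorm_mono
    intro k
    have hl := h.lin (dotp (V k) z₁) (dotp (V k) y₁) (dotp (V k) y₂)
    have e0 : dotp (V k) y₂ - dotp (V k) y₁ = dotp (V k) u := by rw [hu, dotp_sub]
    have e1 : dotp (V k) u = r * dotp (V k) u' := by rw [hu', dotp_smul]
    simp only [Pi.sub_apply, Pi.smul_apply, Pi.add_apply, featureMap, gf, smul_eq_mul, ht, hhh, lf,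
      dotp_sub]
    rw [e0] at hl
    refine hl.trans ?_
    rw [e1, abs_mul, abs_of_nonneg hr0]
    have hT : 0 ≤ |dotp (V k) y₁ - dotp (V k) z₁| + |dotp (V k) y₂ - dotp (V k) z₁| := by positivity
    generalize |dotp (V k) y₁ - dotp (V k) z₁| + |dotp (V k) y₂ - dotp (V k) z₁| = T at *
    have m1 : |dotp (V k) u'| ≤ M + max (|dotp (V k) u'| - M) 0 := by
      linarith [le_max_left (|dotp (V k) u'| - M) 0]
    have m2 : 0 ≤ max (|dotp (V k) u'| - M) 0 := le_max_right _ _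
    generalize max (|dotp (V k) u'| - M) 0 = H at *
    have m3 : |dotp (V k) u'| * min 2 T ≤ M * T + 2 * H := by
      calc _ ≤ (M + H) * min 2 T := mul_le_mul_of_nonneg_right m1 (le_min (by norm_num) hT)
        _ = M * min 2 T + H * min 2 T := by ring
        _ ≤ M * T + H * 2 := add_le_add (mul_le_mul_of_nonneg_left (min_le_right _ _) hM)
            (mul_le_mul_of_nonneg_left (min_le_left _ _) m2)
        _ = _ := by ring
    have := mul_le_mul_of_nonneg_left m3 (mul_nonneg h.pos.le hr0)
    calc _ = L * r * (|dotp (V k) u'| * min 2 T) := by ring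
      _ ≤ _ := this
  refine main.trans ?_
  rw [eNorm_smul, abs_of_nonneg (mul_nonneg h.pos.le hr0)]
  have b3 : eNorm (M • t + (2 : ℝ) • hh) ≤ M * (2 * A * q * e) + 2 * (δ * q) := by
    refine (eNorm_add_le _ _).trans ?_
    rw [eNorm_smul, eNorm_smul, abs_of_nonneg hM, abs_of_pos (by norm_num : (0:ℝ) < 2)]
    exact add_le_add (mul_le_mul_of_nonneg_left b1 hM) (by linarith)
  calc _ ≤ L * r * (M * (2 * A * q * e) + 2 * (δ * q)) :=
        mul_le_mul_of_nonneg_left b3 (mul_nonneg h.pos.le hr0)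
    _ = _ := by ring

/-- The scalar bootstrap. -/
lemma scalar_bootstrap {c₀ c₁ C η : ℝ} (h0 : 0 < c₀) (h1 : 0 < c₁) (hC : 0 ≤ C) (hη : 0 < η) :
    ∃ τ, 0 < τ ∧ ∀ T B : ℝ, 0 ≤ T → 0 ≤ B → B * (c₀ - τ) ≤ C + T * τ → T * (c₁ - τ) ≤ C + B * τ →
      T * τ ≤ η := by
  set c := min c₀ c₁ with hc
  have hc0 : 0 < c := lt_min h0 h1
  refine ⟨min (c / 4) (η * c / (4 * C + 4)), lt_min (by positivity) (by positivity), ?_⟩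
  intro T B hT hB e1 e2
  set τ := min (c / 4) (η * c / (4 * C + 4)) with hτ
  have t0 : 0 < τ := lt_min (by positivity) (by positivity)
  have t1 : τ ≤ c / 4 := min_le_left _ _
  have t2 : τ * (4 * C + 4) ≤ η * c := (le_div_iff₀ (by positivity)).1 (min_le_right _ _)
  have k0 : c ≤ c₀ := min_le_left _ _
  have k1 : c ≤ c₁ := min_le_right _ _
  -- add the two inequalities
  have s1 : B * (3 * c / 4) ≤ C + T * (c / 4) := by nlinarith
  have s2 : T * (3 * c / 4) ≤ C + B * (c / 4) := by nlinarith
  have s3 : T * c ≤ 4 * C := by linarith [mul_nonneg hB hc0.le]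
  have s4 : T * τ * c ≤ η * c := by nlinarith
  exact le_of_mul_le_mul_right s4 hc0

set_option maxHeartbeats 1000000 in
/-- Deterministic conclusion. -/
lemma det_conclusion {p d : ℕ} {φ : ℝ → ℝ} {L : ℝ} (h : Smooth φ L)
    {V : Fin p → Fin d → ℝ} {z₁ z₂ : Fin d → ℝ} {A M δ c₀ c₁ κ q s e τ C η : ℝ}
    (G : Good φ V z₁ z₂ A M δ c₀ c₁ κ q s) (hA0 : 0 ≤ A) (hM : 0 ≤ M) (hδ : 0 ≤ δ) (he : 0 ≤ e)
    (hp : 0 < p) (hq : q = Real.sqrt p)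
    (hs : 0 < s) (n1 : eNorm z₁ = s) (n2 : eNorm z₂ = s)
    (hC1 : |φ 0| + L * A + |hermiteCoeff φ 1| * A ≤ C)
    (hτ1 : C * L * A * e ≤ τ)
    (hτ2 : |κ| * e + δ + C * (L * (2 * A * M * e + 2 * δ)) ≤ τ)
    (hτ3 : |κ| * e + δ + L ^ 2 * A ^ 2 * e ≤ τ)
    (hτ4 : L * A * (L * (2 * A * M * e + 2 * δ)) ≤ τ)
    (boot : ∀ T B : ℝ, 0 ≤ T → 0 ≤ B → B * (c₀ - τ) ≤ C * C + T * τ →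
      T * (c₁ - τ) ≤ C * C + B * τ → T * τ ≤ η)
    {y₁ y₂ : Fin d → ℝ} (hy1 : eNorm y₁ = s) (hy2 : eNorm y₂ = s)
    (h1 : eNorm (y₁ - z₁) ≤ e * s) (h2 : eNorm (y₂ - z₁) ≤ e * s) {a₁ a₂ : ℝ}
    (heq : featureMap φ V z₂ = (fun k => a₁ * featureMap φ V y₁ k + a₂ * featureMap φ V y₂ k)) :
    |a₂ * dotp (tfeatureMap φ V z₂) (fun k => featureMap φ V y₂ k - featureMap φ V y₁ k)|
      ≤ η * p := by
  have hq0 : 0 < q := by rw [hq]; exact Real.sqrt_pos.2 (by exact_mod_cast hp)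
  have hqp : q ^ 2 = p := by rw [hq]; exact Real.sq_sqrt (by positivity)
  set u := y₂ - y₁ with hu
  set r := eNorm u / s with hr
  have hr0 : 0 ≤ r := div_nonneg (eNorm_nonneg _) hs.le
  set Δ := featureMap φ V y₂ - featureMap φ V y₁ with hΔ
  set g := gf φ V z₁ u with hg
  set R := Δ - g with hR
  set ζ := L * (2 * A * M * e + 2 * δ) with hζ
  have hζ0 : 0 ≤ ζ := by have := h.pos; positivity
  have bR : eNorm R ≤ ζ * q * r := rem_norm_le h G hA0 hM hq0.le hs h1 h2
  have hΔe : Δ = g + R := by rw [hR]; abel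
  have nf : ∀ z, eNorm z = s → eNorm (lf V z) ≤ A * q := fun z hz => by
    have := G.hA z; rwa [hz, div_self hs.ne', mul_one] at this
  have hL := h.pos
  have hC0 : 0 ≤ C := le_trans (by positivity) hC1
  have hCle : |φ 0| + L * A ≤ C := le_trans (le_add_of_nonneg_right (by positivity)) hC1
  have hLA : L * A ≤ C := le_trans (by linarith [abs_nonneg (φ 0)]) hCle
  have bf : ∀ z, eNorm z = s → eNorm (featureMap φ V z) ≤ C * q := fun z hz =>
    (featureMap_norm_le h V z hq (nf z hz)).trans (mul_le_mul_of_nonneg_right hCle hq0.le)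
  have bt : eNorm (tfeatureMap φ V z₂) ≤ C * q :=
    (tfeatureMap_norm_le h V z₂ hq (nf z₂ n2)).trans (mul_le_mul_of_nonneg_right hC1 hq0.le)
  have bu : eNorm (lf V u) ≤ A * q * r := G.hA u
  have bg : eNorm g ≤ L * A * q * r := (gf_norm_le h V z₁ u).trans (by
    have := mul_le_mul_of_nonneg_left bu hL.le; linarith)
  set S := featureMap φ V y₁ - featureMap φ V z₁ with hS
  have bS : eNorm S ≤ L * A * e * q := (featureMap_sub_norm_le h V y₁ z₁).trans (by
    have i1 := G.hA (y₁ - z₁)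
    have j1 : A * q * (eNorm (y₁ - z₁) / s) ≤ A * q * e :=
      mul_le_mul_of_nonneg_left ((div_le_iff₀ hs).2 h1) (mul_nonneg hA0 hq0.le)
    have := mul_le_mul_of_nonneg_left (i1.trans j1) hL.le
    linarith)
  have hSe : featureMap φ V y₁ = featureMap φ V z₁ + S := by rw [hS]; abel
  -- near orthogonality of `z₁` and `u`
  have horth : |dotp z₁ u / s ^ 2| ≤ e * r := by
    have e1 : dotp y₁ y₁ = dotp y₂ y₂ := by rw [← eNorm_sq', ← eNorm_sq', hy1, hy2]
    have e2 : 2 * dotp z₁ u = - (dotp (y₁ - z₁) u + dotp (y₂ - z₁) u) := by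
      rw [hu]; simp only [sub_dotp, dotp_sub]
      rw [dotp_comm y₂ y₁, e1]; ring
    have e3 := abs_dotp_le (y₁ - z₁) u
    have e4 := abs_dotp_le (y₂ - z₁) u
    have nu := eNorm_nonneg u
    have e5 : |dotp z₁ u| ≤ e * s * eNorm u := by
      have : |2 * dotp z₁ u| ≤ 2 * (e * s * eNorm u) := by
        rw [e2, abs_neg]
        refine (abs_add_le _ _).trans ?_
        have := mul_le_mul_of_nonneg_right h1 nu
        have := mul_le_mul_of_nonneg_right h2 nu
        linarith
      rw [abs_mul, abs_of_pos (by norm_num : (0:ℝ) < 2)] at this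
      linarith
    rw [abs_div, abs_of_pos (by positivity : 0 < s ^ 2), div_le_iff₀ (by positivity)]
    refine e5.trans (le_of_eq ?_)
    rw [hr]; field_simp
  have nq : 0 ≤ q ^ 2 := by positivity
  -- first correlation
  have cE : |dotp (featureMap φ V z₁) g| ≤ q ^ 2 * r * (|κ| * e + δ) := by
    have i := G.hE u
    have j : |κ * q ^ 2 * (dotp z₁ u / s ^ 2)| ≤ |κ| * q ^ 2 * (e * r) := by
      rw [abs_mul, abs_mul, abs_of_nonneg nq]
      exact mul_le_mul_of_nonneg_left horth (by positivity)
    calc _ = |(dotp (featureMap φ V z₁) g - κ * q ^ 2 * (dotp z₁ u / s ^ 2)) +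
          κ * q ^ 2 * (dotp z₁ u / s ^ 2)| := by congr 1; ring
      _ ≤ _ := abs_add_le _ _
      _ ≤ δ * q ^ 2 * r + |κ| * q ^ 2 * (e * r) := add_le_add i j
      _ = _ := by ring
  have vec : featureMap φ V z₂ = (a₁ + a₂) • featureMap φ V y₁ + a₂ • Δ := by
    rw [heq]; funext k
    simp [hΔ]; ring
  set b := a₁ + a₂ with hb
  -- generic products
  have prod_le : ∀ (x y : Fin p → ℝ) (X Y : ℝ), eNorm x ≤ X → eNorm y ≤ Y →
      |dotp x y| ≤ X * Y := fun x y X Y hx hy =>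
    (abs_dotp_le x y).trans (mul_le_mul hx hy (eNorm_nonneg _) ((eNorm_nonneg _).trans hx))
  have T0 : 0 ≤ |a₂| * r := by positivity
  have test1 : |b| * (c₀ - τ) ≤ C * C + |a₂| * r * τ := by
    have v := congrArg (dotp (featureMap φ V z₁)) vec
    rw [dotp_add, dotp_smul, dotp_smul, hSe, dotp_add, ← eNorm_sq', hΔe, dotp_add] at v
    have w1 := prod_le _ _ _ _ (bf z₁ n1) (bf z₂ n2)
    have w2 := prod_le _ _ _ _ (bf z₁ n1) bS
    have w3 := prod_le _ _ _ _ (bf z₁ n1) bR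
    have w4 : q ^ 2 * (c₀ - τ) ≤ eNorm (featureMap φ V z₁) ^ 2 + dotp (featureMap φ V z₁) S := by
      have := G.hC
      have := mul_le_mul_of_nonneg_left hτ1 nq
      have := (abs_le.1 w2).1
      linarith
    have w5 : |dotp (featureMap φ V z₁) g + dotp (featureMap φ V z₁) R| ≤ q ^ 2 * r * τ := by
      refine (abs_add_le _ _).trans ((add_le_add cE w3).trans ?_)
      have := mul_le_mul_of_nonneg_left hτ2 (mul_nonneg nq hr0)
      linarith
    have w6 : |b| * (q ^ 2 * (c₀ - τ)) ≤ q ^ 2 * (C * C) + |a₂| * (q ^ 2 * r * τ) := by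
      calc _ ≤ |b| * |eNorm (featureMap φ V z₁) ^ 2 + dotp (featureMap φ V z₁) S| :=
            mul_le_mul_of_nonneg_left (w4.trans (le_abs_self _)) (abs_nonneg _)
        _ = |b * (eNorm (featureMap φ V z₁) ^ 2 + dotp (featureMap φ V z₁) S)| := (abs_mul _ _).symm
        _ = |dotp (featureMap φ V z₁) (featureMap φ V z₂) -
            a₂ * (dotp (featureMap φ V z₁) g + dotp (featureMap φ V z₁) R)| := by
              congr 1; rw [v]; ring
        _ ≤ _ := abs_sub _ _
        _ ≤ _ := by
          rw [abs_mul]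
          refine add_le_add (w1.trans (le_of_eq (by ring))) ?_
          exact mul_le_mul_of_nonneg_left w5 (abs_nonneg _)
    refine le_of_mul_le_mul_left ?_ (by positivity : 0 < q ^ 2)
    linarith
  have test2 : |a₂| * r * (c₁ - τ) ≤ C * C + |b| * τ := by
    rcases hr0.eq_or_lt with hr00 | hrpos
    · rw [← hr00]
      have : 0 ≤ τ := le_trans (by positivity) hτ1
      have : 0 ≤ |b| * τ := by positivity
      have : 0 ≤ C * C := by positivity
      linarith
    have v := congrArg (dotp g) vec
    rw [dotp_add, dotp_smul, dotp_smul, hSe, dotp_add, hΔe, dotp_add, ← eNorm_sq',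
      dotp_comm g (featureMap φ V z₁)] at v
    have w1 := prod_le _ _ _ _ bg (bf z₂ n2)
    have w2 := prod_le _ _ _ _ bg bS
    have w3 := prod_le _ _ _ _ bg bR
    have w4 : q ^ 2 * r ^ 2 * (c₁ - τ) ≤ eNorm g ^ 2 + dotp g R := by
      have := G.hD u
      have := mul_le_mul_of_nonneg_left hτ4 (mul_nonneg nq (sq_nonneg r))
      have := (abs_le.1 w3).1
      linarith
    have w5 : |dotp (featureMap φ V z₁) g + dotp g S| ≤ q ^ 2 * r * τ := by
      refine (abs_add_le _ _).trans ((add_le_add cE w2).trans ?_)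
      have := mul_le_mul_of_nonneg_left hτ3 (mul_nonneg nq hr0)
      linarith
    have w7 : |dotp g (featureMap φ V z₂)| ≤ q ^ 2 * r * (C * C) := by
      refine w1.trans ?_
      have := mul_le_mul_of_nonneg_left (mul_le_mul_of_nonneg_right hLA hC0) (mul_nonneg nq hr0)
      linarith
    have w6 : |a₂| * (q ^ 2 * r ^ 2 * (c₁ - τ)) ≤ q ^ 2 * r * (C * C) + |b| * (q ^ 2 * r * τ) := by
      calc _ ≤ |a₂| * |eNorm g ^ 2 + dotp g R| :=
            mul_le_mul_of_nonneg_left (w4.trans (le_abs_self _)) (abs_nonneg _)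
        _ = |a₂ * (eNorm g ^ 2 + dotp g R)| := (abs_mul _ _).symm
        _ = |dotp g (featureMap φ V z₂) -
            b * (dotp (featureMap φ V z₁) g + dotp g S)| := by
              congr 1; rw [v]; ring
        _ ≤ _ := abs_sub _ _
        _ ≤ _ := by
          rw [abs_mul]
          exact add_le_add w7 (mul_le_mul_of_nonneg_left w5 (abs_nonneg _))
    refine le_of_mul_le_mul_left ?_ (by positivity : 0 < q ^ 2 * r)
    linarith
  have hT := boot (|a₂| * r) |b| T0 (abs_nonneg _) test1 test2
  have hΔ' : (fun k => featureMap φ V y₂ k - featureMap φ V y₁ k) = g + R := by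
    rw [← hΔe]; rfl
  rw [hΔ', dotp_add, abs_mul]
  have f1 := G.hF u
  have f2 := prod_le _ _ _ _ bt bR
  have f3 : |dotp (tfeatureMap φ V z₂) g + dotp (tfeatureMap φ V z₂) R| ≤ q ^ 2 * r * τ := by
    refine (abs_add_le _ _).trans ((add_le_add f1 f2).trans ?_)
    have : 0 ≤ |κ| * e := by positivity
    have := mul_le_mul_of_nonneg_left (show δ + C * ζ ≤ τ by linarith) (mul_nonneg nq hr0)
    linarith
  calc _ ≤ |a₂| * (q ^ 2 * r * τ) := mul_le_mul_of_nonneg_left f3 (abs_nonneg _)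
    _ = |a₂| * r * τ * q ^ 2 := by ring
    _ ≤ η * q ^ 2 := mul_le_mul_of_nonneg_right hT nq
    _ = _ := by rw [hqp]


/-! ## Part 3: nets and passage from the net to the whole space -/

open scoped Function in
lemma card_le_of_sep {E : Type*} [NormedAddCommGroup E] [NormedSpace ℝ E] [FiniteDimensional ℝ E]
    {θ : ℝ} (hθ : 0 < θ) (s : Finset E) (hs : ∀ c ∈ s, ‖c‖ ≤ 1)
    (h : ∀ c ∈ s, ∀ d ∈ s, c ≠ d → θ ≤ ‖c - d‖) :
    (s.card : ℝ) ≤ (1 + 2 / θ) ^ Module.finrank ℝ E := by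
  borelize E
  let μ : Measure E := Measure.addHaar
  let δ : ℝ := θ / 2
  let ρ : ℝ := 1 + θ / 2
  have δpos : 0 < δ := by positivity
  have ρpos : 0 < ρ := by positivity
  set A := ⋃ c ∈ s, Metric.ball (c : E) δ with hA
  have D : Set.Pairwise (s : Set E) (Disjoint on fun c => Metric.ball (c : E) δ) := by
    rintro c hc d hd hcd
    apply Metric.ball_disjoint_ball
    rw [dist_eq_norm]
    have := h c hc d hd hcd
    simp only [δ]; linarith
  have A_subset : A ⊆ Metric.ball (0 : E) ρ := by
    refine Set.iUnion₂_subset fun x hx => ?_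
    apply Metric.ball_subset_ball'
    rw [dist_zero_right]
    have := hs x hx
    simp only [δ, ρ]; linarith
  have I :
    (s.card : ENNReal) * ENNReal.ofReal (δ ^ Module.finrank ℝ E) * μ (Metric.ball 0 1) ≤
      ENNReal.ofReal (ρ ^ Module.finrank ℝ E) * μ (Metric.ball 0 1) :=
    calc
      (s.card : ENNReal) * ENNReal.ofReal (δ ^ Module.finrank ℝ E) * μ (Metric.ball 0 1) = μ A := by
        rw [hA, measure_biUnion_finset D fun c _ => measurableSet_ball]
        simp only [μ.addHaar_ball_of_pos _ δpos]
        simp only [Finset.sum_const, nsmul_eq_mul, mul_assoc]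
      _ ≤ μ (Metric.ball (0 : E) ρ) := measure_mono A_subset
      _ = ENNReal.ofReal (ρ ^ Module.finrank ℝ E) * μ (Metric.ball 0 1) := by
        simp only [μ.addHaar_ball_of_pos _ ρpos]
  have J : (s.card : ENNReal) * ENNReal.ofReal (δ ^ Module.finrank ℝ E) ≤
      ENNReal.ofReal (ρ ^ Module.finrank ℝ E) :=
    (ENNReal.mul_le_mul_iff_left (Metric.measure_ball_pos _ _ zero_lt_one).ne'
      measure_ball_lt_top.ne).1 I
  have K := ENNReal.toReal_le_of_le_ofReal (pow_nonneg ρpos.le _) J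
  rw [ENNReal.toReal_mul, ENNReal.toReal_natCast, ENNReal.toReal_ofReal (by positivity)] at K
  have e : (1 + 2 / θ) = ρ / δ := by simp only [ρ, δ]; field_simp; ring
  rw [e, div_pow, le_div_iff₀ (by positivity)]
  exact K

lemma exists_net (d : ℕ) (hd : 0 < d) {θ : ℝ} (hθ : 0 < θ) :
    ∃ N : Finset (Fin d → ℝ), (∀ u ∈ N, eNorm u = Real.sqrt d) ∧
      (∀ u, eNorm u = Real.sqrt d → ∃ u₀ ∈ N, eNorm (u - u₀) ≤ θ * Real.sqrt d) ∧
      (N.card : ℝ) ≤ (1 + 2 / θ) ^ d := by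
  classical
  have hs : 0 < Real.sqrt d := Real.sqrt_pos.2 (by exact_mod_cast hd)
  set s := Real.sqrt d with hsd
  let Q : Finset (Fin d → ℝ) → Prop := fun N => (∀ u ∈ N, eNorm u = s) ∧
    ∀ u ∈ N, ∀ w ∈ N, u ≠ w → θ * s ≤ eNorm (u - w)
  have bound : ∀ N, Q N → (N.card : ℝ) ≤ (1 + 2 / θ) ^ d := by
    intro N hN
    let f : (Fin d → ℝ) → EuclideanSpace ℝ (Fin d) := fun u => s⁻¹ • WithLp.toLp 2 u
    have finj : Function.Injective f := fun a b hab => by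
      have := smul_right_injective _ (inv_ne_zero hs.ne') hab
      simpa using this
    have fn : ∀ u, ‖f u‖ = s⁻¹ * eNorm u := fun u => by
      simp only [f, norm_smul, norm_inv, Real.norm_eq_abs, abs_of_pos hs, eNorm_eq_norm]
    have fs : ∀ u w, ‖f u - f w‖ = s⁻¹ * eNorm (u - w) := fun u w => by
      rw [← fn]; simp only [f, WithLp.toLp_sub, smul_sub]
    have := card_le_of_sep (E := EuclideanSpace ℝ (Fin d)) hθ (N.image f) ?_ ?_
    · rwa [Finset.card_image_of_injective _ finj, finrank_euclideanSpace_fin] at this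
    · intro c hc
      obtain ⟨u, hu, rfl⟩ := Finset.mem_image.1 hc
      rw [fn, hN.1 u hu, inv_mul_cancel₀ hs.ne']
    · intro c hc c' hc' hne
      obtain ⟨u, hu, rfl⟩ := Finset.mem_image.1 hc
      obtain ⟨w, hw, rfl⟩ := Finset.mem_image.1 hc'
      rw [fs]
      have := hN.2 u hu w hw (fun h => hne (by rw [h]))
      rw [← div_eq_inv_mul, le_div_iff₀ hs]; exact this
  obtain ⟨m, hm⟩ := exists_nat_ge ((1 + 2 / θ) ^ d)
  have hQ0 : ∃ n, ∃ N, Q N ∧ N.card = n := ⟨0, ∅, ⟨by simp, by simp⟩, rfl⟩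
  obtain ⟨n, ⟨N, hN, hNc⟩, hmax⟩ : ∃ n, (∃ N, Q N ∧ N.card = n) ∧
      ∀ n', (∃ N, Q N ∧ N.card = n') → n' ≤ n := by
    have hb : ∀ n', (∃ N, Q N ∧ N.card = n') → n' ≤ m := by
      rintro _ ⟨N, hN, rfl⟩
      exact_mod_cast (bound N hN).trans hm
    refine ⟨Nat.findGreatest (fun n => ∃ N, Q N ∧ N.card = n) m, ?_, ?_⟩
    · obtain ⟨n, hn⟩ := hQ0
      exact Nat.findGreatest_spec (P := fun n => ∃ N, Q N ∧ N.card = n) (hb n hn) hn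
    · intro n' hn'
      exact Nat.le_findGreatest (hb n' hn') hn'
  refine ⟨N, hN.1, fun u hu => ?_, bound N hN⟩
  by_contra hcon
  push Not at hcon
  have hu0 : u ∉ N := fun h => by
    have := hcon u h
    rw [sub_self] at this
    have e0 : eNorm (0 : Fin d → ℝ) = 0 := by simp [eNorm]
    rw [e0] at this
    have : 0 < θ * s := by positivity
    linarith
  have : Q (insert u N) := by
    refine ⟨fun w hw => ?_, fun a ha b hb hab => ?_⟩
    · rcases Finset.mem_insert.1 hw with rfl | h
      · exact hu
      · exact hN.1 w h
    · rcases Finset.mem_insert.1 ha with rfl | ha' <;> rcases Finset.mem_insert.1 hb with rfl | hb'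
      · exact absurd rfl hab
      · exact (hcon b hb').le
      · rw [← eNorm_neg, neg_sub]; exact (hcon a ha').le
      · exact hN.2 a ha' b hb' hab
  have := hmax _ ⟨_, this, rfl⟩
  rw [Finset.card_insert_of_notMem hu0] at this
  omega

lemma exists_dir {d : ℕ} (hd : 0 < d) (u : Fin d → ℝ) : ∃ u' : Fin d → ℝ,
    eNorm u' = Real.sqrt d ∧ u = (eNorm u / Real.sqrt d) • u' := by
  have hs : 0 < Real.sqrt d := Real.sqrt_pos.2 (by exact_mod_cast hd)
  by_cases h0 : eNorm u = 0
  · refine ⟨fun _ => 1, by simp [eNorm], ?_⟩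
    rw [h0, zero_div, zero_smul]
    rw [eNorm_eq_norm, norm_eq_zero] at h0
    simpa using h0
  · refine ⟨(eNorm u / Real.sqrt d)⁻¹ • u, ?_, ?_⟩
    · rw [eNorm_smul, abs_of_nonneg (inv_nonneg.2 (div_nonneg (eNorm_nonneg _) hs.le))]
      field_simp
    · rw [smul_smul, mul_inv_cancel₀ (div_ne_zero h0 hs.ne'), one_smul]

lemma gf_sub {p d : ℕ} (φ : ℝ → ℝ) (V : Fin p → Fin d → ℝ) (z u w : Fin d → ℝ) :
    gf φ V z (u - w) = gf φ V z u - gf φ V z w := by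
  funext k; simp [gf, dotp_sub, mul_sub]

lemma gf_smul {p d : ℕ} (φ : ℝ → ℝ) (V : Fin p → Fin d → ℝ) (z u : Fin d → ℝ) (a : ℝ) :
    gf φ V z (a • u) = a • gf φ V z u := by
  funext k; simp [gf, dotp_smul]; ring

/-- The finitely many conditions on the net. -/
structure NetGood {p d : ℕ} (φ : ℝ → ℝ) (V : Fin p → Fin d → ℝ) (z₁ z₂ : Fin d → ℝ)
    (N : Finset (Fin d → ℝ)) (M δ c₀ c₁ κ : ℝ) : Prop where
  nA : ∀ u ∈ N, eNorm (lf V u) ^ 2 ≤ 2 * p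
  nB : ∀ u ∈ N, eNorm (fun k => max (|lf V u k| - M) 0) ^ 2 ≤ δ ^ 2 * p
  nC : c₀ * p ≤ eNorm (featureMap φ V z₁) ^ 2
  nD : ∀ u ∈ N, c₁ * p ≤ eNorm (gf φ V z₁ u) ^ 2
  nE : ∀ u ∈ N, |dotp (featureMap φ V z₁) (gf φ V z₁ u) - κ * p * (dotp z₁ u / d)| ≤ δ * p
  nF : ∀ u ∈ N, |dotp (tfeatureMap φ V z₂) (gf φ V z₁ u)| ≤ δ * p

lemma NetGood.good {p d : ℕ} {φ : ℝ → ℝ} {L : ℝ} (h : Smooth φ L)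
    {V : Fin p → Fin d → ℝ} {z₁ z₂ : Fin d → ℝ}
    {N : Finset (Fin d → ℝ)} {M δ δ' c₀ c₁ κ θ C : ℝ} (G : NetGood φ V z₁ z₂ N M δ c₀ c₁ κ)
    (hd : 0 < d) (hp : 0 < p) (n1 : eNorm z₁ = Real.sqrt d) (n2 : eNorm z₂ = Real.sqrt d)
    (hN : ∀ u, eNorm u = Real.sqrt d → ∃ u₀ ∈ N, eNorm (u - u₀) ≤ θ * Real.sqrt d)
    (hM : 0 ≤ M) (hδ : 0 ≤ δ) (hθ0 : 0 < θ) (hθ : θ ≤ 1 / 2) (hc₁ : 0 < c₁)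
    (hC1 : |φ 0| + L * 3 + |hermiteCoeff φ 1| * 3 ≤ C)
    (q1 : δ + 3 * θ ≤ δ') (q2 : 3 * L * θ ≤ Real.sqrt c₁ / 2)
    (q3 : δ + |κ| * θ + C * (L * 3 * θ) ≤ δ') :
    Good φ V z₁ z₂ 3 M δ' c₀ (c₁ / 4) κ (Real.sqrt p) (Real.sqrt d) := by
  have hs : 0 < Real.sqrt d := Real.sqrt_pos.2 (by exact_mod_cast hd)
  have hq : 0 < Real.sqrt p := Real.sqrt_pos.2 (by exact_mod_cast hp)
  have hs2 : Real.sqrt d ^ 2 = d := Real.sq_sqrt (by positivity)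
  have hq2 : Real.sqrt p ^ 2 = p := Real.sq_sqrt (by positivity)
  set s := Real.sqrt d with hsd
  set q := Real.sqrt p with hqp
  have hL := h.pos
  -- the operator norm bound
  have hA : ∀ u, eNorm (lf V u) ≤ 3 * q * (eNorm u / s) := by
    let T : EuclideanSpace ℝ (Fin d) →ₗ[ℝ] EuclideanSpace ℝ (Fin p) :=
      { toFun := fun u => WithLp.toLp 2 (lf V u.ofLp)
        map_add' := fun a b => by rw [WithLp.ofLp_add, lf_add, WithLp.toLp_add]
        map_smul' := fun a b => by rw [WithLp.ofLp_smul, lf_smul, WithLp.toLp_smul]; rfl }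
    let T' := LinearMap.toContinuousLinearMap T
    have hT : ∀ u, eNorm (lf V u) = ‖T' (WithLp.toLp 2 u)‖ := fun u => by
      rw [eNorm_eq_norm]; rfl
    have hop : ∀ u, eNorm (lf V u) ≤ ‖T'‖ * eNorm u := fun u => by
      rw [hT, eNorm_eq_norm u]; exact T'.le_opNorm _
    have step : ∀ u, eNorm (lf V u) ≤ ((3 / 2 * q + ‖T'‖ * (θ * s)) / s) * eNorm u := by
      intro u
      obtain ⟨u', hu', e⟩ := exists_dir hd u
      obtain ⟨u₀, h0, hu0⟩ := hN u' hu'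
      have a1 : eNorm (lf V u₀) ≤ 3 / 2 * q := by
        apply abs_le_of_sq_le_sq' _ (by positivity) |>.2
        rw [mul_pow, hq2]
        have := G.nA u₀ h0
        have : (0:ℝ) ≤ p := by positivity
        linarith
      have a2 : eNorm (lf V u') ≤ 3 / 2 * q + ‖T'‖ * (θ * s) := by
        have : lf V u' = lf V u₀ + lf V (u' - u₀) := by rw [lf_sub]; abel
        rw [this]
        refine (eNorm_add_le _ _).trans (add_le_add a1 ((hop _).trans ?_))
        exact mul_le_mul_of_nonneg_left hu0 (norm_nonneg _)
      have a3 : eNorm (lf V u) = eNorm u / s * eNorm (lf V u') := by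
        conv_lhs => rw [e, lf_smul, eNorm_smul]
        rw [abs_of_nonneg (div_nonneg (eNorm_nonneg _) hs.le)]
      rw [a3]
      calc _ ≤ eNorm u / s * (3 / 2 * q + ‖T'‖ * (θ * s)) :=
            mul_le_mul_of_nonneg_left a2 (div_nonneg (eNorm_nonneg _) hs.le)
        _ = _ := by ring
    have hTn : ‖T'‖ ≤ (3 / 2 * q + ‖T'‖ * (θ * s)) / s := by
      refine ContinuousLinearMap.opNorm_le_bound _ (by positivity) fun x => ?_
      have := step x.ofLp
      rwa [hT, eNorm_eq_norm] at this
    have hTn2 : ‖T'‖ ≤ 3 * q / s := by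
      rw [le_div_iff₀ hs] at hTn ⊢
      have : ‖T'‖ * (θ * s) ≤ ‖T'‖ * s * (1 / 2) := by
        have := mul_le_mul_of_nonneg_left hθ (mul_nonneg (norm_nonneg T') hs.le)
        linarith
      linarith
    intro u
    refine (hop u).trans ?_
    calc _ ≤ 3 * q / s * eNorm u := mul_le_mul_of_nonneg_right hTn2 (eNorm_nonneg _)
      _ = _ := by ring
  have nf : ∀ z, eNorm z = s → eNorm (lf V z) ≤ 3 * q := fun z hz => by
    have := hA z; rwa [hz, div_self hs.ne', mul_one] at this
  have hθn : ∀ w, eNorm w ≤ θ * s → eNorm (lf V w) ≤ 3 * θ * q := fun w hw => by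
    refine (hA w).trans ?_
    have : eNorm w / s ≤ θ := (div_le_iff₀ hs).2 hw
    have := mul_le_mul_of_nonneg_left this (by positivity : 0 ≤ 3 * q)
    linarith
  have hCle : |φ 0| + L * 3 ≤ C := le_trans (le_add_of_nonneg_right (by positivity)) hC1
  have bf : eNorm (featureMap φ V z₁) ≤ C * q :=
    (featureMap_norm_le h V z₁ hqp (nf z₁ n1)).trans (mul_le_mul_of_nonneg_right hCle hq.le)
  have bt : eNorm (tfeatureMap φ V z₂) ≤ C * q :=
    (tfeatureMap_norm_le h V z₂ hqp (nf z₂ n2)).trans (mul_le_mul_of_nonneg_right hC1 hq.le)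
  have bgw : ∀ w, eNorm w ≤ θ * s → eNorm (gf φ V z₁ w) ≤ L * 3 * θ * q := fun w hw => by
    refine (gf_norm_le h V z₁ w).trans ?_
    have := mul_le_mul_of_nonneg_left (hθn w hw) hL.le
    linarith
  have hC0 : 0 ≤ C := le_trans (by positivity) hCle
  have prod_le : ∀ (x y : Fin p → ℝ) (X Y : ℝ), eNorm x ≤ X → eNorm y ≤ Y →
      |dotp x y| ≤ X * Y := fun x y X Y hx hy =>
    (abs_dotp_le x y).trans (mul_le_mul hx hy (eNorm_nonneg _) ((eNorm_nonneg _).trans hx))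
  refine ⟨hA, ?_, by rw [hq2]; exact G.nC, ?_, ?_, ?_⟩
  · intro u hu
    obtain ⟨u', hu', e⟩ := exists_dir hd u
    obtain ⟨u₀, h0, hu0⟩ := hN u' hu'
    have t1 : eNorm u / s ≤ 1 := (div_le_one hs).2 hu
    have t0 : 0 ≤ eNorm u / s := div_nonneg (eNorm_nonneg _) hs.le
    have a1 : eNorm (fun k => max (|lf V u₀ k| - M) 0) ≤ δ * q := by
      apply abs_le_of_sq_le_sq' _ (by positivity) |>.2
      rw [mul_pow, hq2]
      exact G.nB u₀ h0
    have a2 : eNorm (fun k => max (|lf V u k| - M) 0) ≤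
        eNorm ((fun k => max (|lf V u₀ k| - M) 0) + fun k => |lf V (u' - u₀) k|) := by
      apply eNorm_mono
      intro k
      rw [abs_of_nonneg (le_max_right _ _)]
      have f1 : |lf V u k| ≤ |lf V u' k| := by
        rw [e, lf_smul]
        simp only [Pi.smul_apply, smul_eq_mul, abs_mul]
        rw [← hsd, abs_of_nonneg t0]
        exact mul_le_of_le_one_left (abs_nonneg _) t1
      have f2 : |lf V u' k| ≤ |lf V u₀ k| + |lf V (u' - u₀) k| := by
        calc _ = |lf V u₀ k + lf V (u' - u₀) k| := by rw [lf_sub]; simp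
          _ ≤ _ := abs_add_le _ _
      simp only [Pi.add_apply]
      have := le_max_left (|lf V u₀ k| - M) 0
      have := le_max_right (|lf V u₀ k| - M) 0
      have := abs_nonneg (lf V (u' - u₀) k)
      exact max_le (by linarith) (by linarith)
    refine a2.trans ((eNorm_add_le _ _).trans ?_)
    rw [eNorm_abs]
    have := hθn _ hu0
    have := mul_le_mul_of_nonneg_right q1 hq.le
    linarith
  · intro u
    obtain ⟨u', hu', e⟩ := exists_dir hd u
    obtain ⟨u₀, h0, hu0⟩ := hN u' hu'
    have a1 : Real.sqrt c₁ * q ≤ eNorm (gf φ V z₁ u₀) := by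
      apply abs_le_of_sq_le_sq' _ (eNorm_nonneg _) |>.2
      rw [mul_pow, hq2, Real.sq_sqrt hc₁.le]
      exact G.nD u₀ h0
    have a2 : Real.sqrt c₁ * q ≤ eNorm (gf φ V z₁ u') + L * 3 * θ * q := by
      refine a1.trans ?_
      have : gf φ V z₁ u₀ = gf φ V z₁ u' - gf φ V z₁ (u' - u₀) := by rw [gf_sub]; abel
      rw [this]
      exact (eNorm_sub_le _ _).trans (add_le_add le_rfl (bgw _ hu0))
    have a3 : Real.sqrt c₁ / 2 * q ≤ eNorm (gf φ V z₁ u') := by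
      have := mul_le_mul_of_nonneg_right q2 hq.le
      linarith
    have a4 : c₁ / 4 * q ^ 2 ≤ eNorm (gf φ V z₁ u') ^ 2 := by
      have := pow_le_pow_left₀ (by positivity) a3 2
      rw [mul_pow, div_pow, Real.sq_sqrt hc₁.le] at this
      linarith
    have a5 : eNorm (gf φ V z₁ u) ^ 2 = (eNorm u / s) ^ 2 * eNorm (gf φ V z₁ u') ^ 2 := by
      conv_lhs => rw [e, gf_smul, eNorm_smul]
      rw [mul_pow, sq_abs]
    rw [a5]
    have := mul_le_mul_of_nonneg_left a4 (sq_nonneg (eNorm u / s))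
    linarith
  · intro u
    obtain ⟨u', hu', e⟩ := exists_dir hd u
    obtain ⟨u₀, h0, hu0⟩ := hN u' hu'
    have hr0 : 0 ≤ eNorm u / s := div_nonneg (eNorm_nonneg _) hs.le
    have b1 := G.nE u₀ h0
    have b2 := prod_le _ _ _ _ bf (bgw _ hu0)
    have b3 : |dotp z₁ (u' - u₀) / d| ≤ θ := by
      rw [abs_div, abs_of_pos (by positivity : (0:ℝ) < d), div_le_iff₀ (by positivity), ← hs2]
      refine (abs_dotp_le _ _).trans ?_
      rw [n1]
      have := mul_le_mul_of_nonneg_left hu0 hs.le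
      linarith
    have b4 : |κ * p * (dotp z₁ (u' - u₀) / d)| ≤ |κ| * p * θ := by
      rw [abs_mul, abs_mul, abs_of_nonneg (by positivity : (0:ℝ) ≤ p)]
      exact mul_le_mul_of_nonneg_left b3 (by positivity)
    have b5 : |dotp (featureMap φ V z₁) (gf φ V z₁ u') - κ * q ^ 2 * (dotp z₁ u' / s ^ 2)|
        ≤ δ' * q ^ 2 := by
      rw [hq2, hs2]
      calc _ = |(dotp (featureMap φ V z₁) (gf φ V z₁ u₀) - κ * p * (dotp z₁ u₀ / d)) +
            dotp (featureMap φ V z₁) (gf φ V z₁ (u' - u₀)) - κ * p * (dotp z₁ (u' - u₀) / d)| := by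
              congr 1; rw [gf_sub, dotp_sub, dotp_sub]; ring
        _ ≤ _ := abs_sub _ _
        _ ≤ _ := add_le_add (abs_add_le _ _) le_rfl
        _ ≤ _ := add_le_add (add_le_add b1 b2) b4
        _ ≤ _ := by
          have := mul_le_mul_of_nonneg_right q3 (by positivity : (0:ℝ) ≤ p)
          have e1 : C * q * (L * 3 * θ * q) = C * (L * 3 * θ) * p := by rw [← hq2]; ring
          rw [e1]; linarith
    have e2 : dotp (featureMap φ V z₁) (gf φ V z₁ u) - κ * q ^ 2 * (dotp z₁ u / s ^ 2) =
        eNorm u / s * (dotp (featureMap φ V z₁) (gf φ V z₁ u') -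
          κ * q ^ 2 * (dotp z₁ u' / s ^ 2)) := by
      rw [← hsd] at e
      generalize eNorm u / s = r at *
      rw [e, gf_smul, dotp_smul, dotp_smul]; ring
    rw [e2, abs_mul, abs_of_nonneg hr0]
    have := mul_le_mul_of_nonneg_left b5 hr0
    linarith
  · intro u
    obtain ⟨u', hu', e⟩ := exists_dir hd u
    obtain ⟨u₀, h0, hu0⟩ := hN u' hu'
    have hr0 : 0 ≤ eNorm u / s := div_nonneg (eNorm_nonneg _) hs.le
    have b1 := G.nF u₀ h0
    have b2 := prod_le _ _ _ _ bt (bgw _ hu0)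
    have b5 : |dotp (tfeatureMap φ V z₂) (gf φ V z₁ u')| ≤ δ' * q ^ 2 := by
      rw [hq2]
      calc _ = |dotp (tfeatureMap φ V z₂) (gf φ V z₁ u₀) +
            dotp (tfeatureMap φ V z₂) (gf φ V z₁ (u' - u₀))| := by
              congr 1; rw [gf_sub, dotp_sub]; ring
        _ ≤ _ := abs_add_le _ _
        _ ≤ _ := add_le_add b1 b2
        _ ≤ _ := by
          have := mul_le_mul_of_nonneg_right q3 (by positivity : (0:ℝ) ≤ p)
          have e1 : C * q * (L * 3 * θ * q) = C * (L * 3 * θ) * p := by rw [← hq2]; ring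
          have : 0 ≤ |κ| * θ * p := by positivity
          rw [e1]; linarith
    have e2 : dotp (tfeatureMap φ V z₂) (gf φ V z₁ u) =
        eNorm u / s * dotp (tfeatureMap φ V z₂) (gf φ V z₁ u') := by
      rw [← hsd] at e
      generalize eNorm u / s = r at *
      rw [e, gf_smul, dotp_smul]
    rw [e2, abs_mul, abs_of_nonneg hr0]
    have := mul_le_mul_of_nonneg_left b5 hr0
    linarith


/-! ## Part 4: Gaussian vectors and concentration -/

/-- The law of one row. -/
def gv (d : ℕ) : Measure (Fin d → ℝ) := Measure.pi fun _ => gaussianReal 0 ((d : NNReal))⁻¹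

instance (d : ℕ) : IsProbabilityMeasure (gv d) := by unfold gv; infer_instance

instance (p d : ℕ) : IsProbabilityMeasure (gaussianMatrix p d) := by
  unfold gaussianMatrix; infer_instance

lemma continuous_dotp {d : ℕ} (u : Fin d → ℝ) : Continuous fun v : Fin d → ℝ => dotp v u := by
  unfold dotp; fun_prop

lemma measurable_dotp {d : ℕ} (u : Fin d → ℝ) : Measurable fun v : Fin d → ℝ => dotp v u :=
  (continuous_dotp u).measurable

/-- `dotp · u` as a continuous linear map. -/
def dotL {d : ℕ} (u : Fin d → ℝ) : (Fin d → ℝ) →L[ℝ] ℝ :=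
  LinearMap.toContinuousLinearMap
    { toFun := fun v => dotp v u
      map_add' := fun a b => add_dotp a b u
      map_smul' := fun a b => smul_dotp a b u }

lemma gv_hasGaussianLaw (d : ℕ) : HasGaussianLaw (fun v : Fin d → ℝ => fun j => v j) (gv d) := by
  apply iIndepFun.hasGaussianLaw (X := fun j (v : Fin d → ℝ) => v j)
  · intro j
    constructor
    have : (gv d).map (fun v => v j) = gaussianReal 0 ((d : NNReal))⁻¹ :=
      (measurePreserving_eval (fun _ : Fin d => gaussianReal 0 ((d : NNReal))⁻¹) j).map_eq
    rw [this]
    infer_instance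
  · exact iIndepFun_pi (μ := fun _ : Fin d => gaussianReal 0 ((d : NNReal))⁻¹)
      (X := fun _ x => x) (fun _ => aemeasurable_id)

lemma gv_joint {d n : ℕ} (W : Fin n → Fin d → ℝ) :
    HasGaussianLaw (fun v => fun i => dotp v (W i)) (gv d) :=
  (gv_hasGaussianLaw d).map_fun (ContinuousLinearMap.pi fun i => dotL (W i))

lemma gv_one {d : ℕ} (u : Fin d → ℝ) : HasGaussianLaw (fun v => dotp v u) (gv d) :=
  (gv_hasGaussianLaw d).map_fun (dotL u)

lemma gv_coord_law (d : ℕ) (j : Fin d) :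
    (gv d).map (fun v => v j) = gaussianReal 0 ((d : NNReal))⁻¹ :=
  (measurePreserving_eval (fun _ : Fin d => gaussianReal 0 ((d : NNReal))⁻¹) j).map_eq

lemma gv_coord_memLp (d : ℕ) (j : Fin d) : MemLp (fun v : Fin d → ℝ => v j) 2 (gv d) :=
  ((gv_hasGaussianLaw d).eval j).memLp_two

lemma gv_coord_mean (d : ℕ) (j : Fin d) : ∫ v, v j ∂(gv d) = 0 := by
  have h := integral_map (μ := gv d) (φ := fun v => v j) (measurable_pi_apply j).aemeasurable
    (f := fun x : ℝ => x) aestronglyMeasurable_id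
  rw [← h, gv_coord_law, integral_id_gaussianReal]

lemma gv_coord_cov (d : ℕ) (i j : Fin d) :
    cov[fun v : Fin d → ℝ => v i, fun v => v j; gv d] = if i = j then ((d : ℝ))⁻¹ else 0 := by
  split_ifs with h
  · subst h
    rw [covariance_self (measurable_pi_apply i).aemeasurable]
    have := variance_map (μ := gv d) (X := fun x : ℝ => x) (Y := fun v : Fin d → ℝ => v i)
      (by fun_prop) (measurable_pi_apply i).aemeasurable
    rw [gv_coord_law, variance_fun_id_gaussianReal] at this
    simpa [Function.comp_def] using this.symm
  · have hi := iIndepFun_pi (μ := fun _ : Fin d => gaussianReal 0 ((d : NNReal))⁻¹)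
      (X := fun _ x => x) (fun _ => aemeasurable_id)
    exact (hi.indepFun h).covariance_eq_zero (gv_coord_memLp d i) (gv_coord_memLp d j)

lemma gv_mean {d : ℕ} (u : Fin d → ℝ) : ∫ v, dotp v u ∂(gv d) = 0 := by
  unfold dotp
  rw [integral_finsetSum]
  · apply Finset.sum_eq_zero
    intro j _
    rw [integral_mul_const, gv_coord_mean, zero_mul]
  · intro j _
    exact ((gv_coord_memLp d j).integrable (by norm_num)).mul_const _

lemma gv_cov {d : ℕ} (u w : Fin d → ℝ) :
    cov[fun v => dotp v u, fun v => dotp v w; gv d] = dotp u w / d := by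
  unfold dotp
  rw [covariance_fun_sum_fun_sum (fun i => (gv_coord_memLp d i).mul_const _)
    (fun i => (gv_coord_memLp d i).mul_const _)]
  simp only [covariance_mul_const_left, covariance_mul_const_right, gv_coord_cov]
  rw [Finset.sum_div]
  refine Finset.sum_congr rfl fun i _ => ?_
  simp [div_eq_mul_inv]
  ring

lemma gv_sq {d : ℕ} (u : Fin d → ℝ) : ∫ v, (dotp v u) ^ 2 ∂(gv d) = dotp u u / d := by
  have h := gv_cov u u
  rw [covariance_self (measurable_dotp u).aemeasurable,
    variance_of_integral_eq_zero (measurable_dotp u).aemeasurable (gv_mean u)] at h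
  exact h

lemma gv_law {d : ℕ} (hd : 0 < d) (u : Fin d → ℝ) (hu : eNorm u = Real.sqrt d) :
    (gv d).map (fun v => dotp v u) = gaussianReal 0 1 := by
  rw [(gv_one u).map_eq_gaussianReal, gv_mean,
    variance_of_integral_eq_zero (measurable_dotp u).aemeasurable (gv_mean u), gv_sq, ← eNorm_sq', hu,
    Real.sq_sqrt (by positivity), div_self (by positivity)]
  simp

lemma gv_indep {d n : ℕ} (W : Fin n → Fin d → ℝ) (hW : ∀ i j, i ≠ j → dotp (W i) (W j) = 0) :
    iIndepFun (fun i v => dotp v (W i)) (gv d) := by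
  apply (gv_joint W).iIndepFun_of_covariance_eq_zero
  intro i j hij
  rw [gv_cov, hW i j hij, zero_div]

lemma gv_integral_comp {d : ℕ} (hd : 0 < d) (u : Fin d → ℝ) (hu : eNorm u = Real.sqrt d)
    {f : ℝ → ℝ} (hf : Measurable f) :
    ∫ v, f (dotp v u) ∂(gv d) = ∫ g, f g ∂(gaussianReal 0 1) := by
  rw [← gv_law hd u hu, integral_map (measurable_dotp u).aemeasurable hf.aestronglyMeasurable]

lemma gv_sq_integrable {d : ℕ} (u : Fin d → ℝ) : Integrable (fun v => (dotp v u) ^ 2) (gv d) :=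
  (gv_one u).memLp_two.integrable_sq

lemma gv_integrable {d : ℕ} (a b c : Fin d → ℝ) {X : (Fin d → ℝ) → ℝ} (hX : Measurable X) {C : ℝ}
    (h : ∀ v, |X v| ≤ C * (1 + (dotp v a) ^ 2 + (dotp v b) ^ 2 + (dotp v c) ^ 2)) :
    Integrable X (gv d) := by
  refine Integrable.mono' (((((integrable_const (1:ℝ)).add (gv_sq_integrable a)).add
    (gv_sq_integrable b)).add (gv_sq_integrable c)).const_mul C) hX.aestronglyMeasurable ?_
  exact Eventually.of_forall h

lemma exp_sq_integrable : Integrable (fun x : ℝ => Real.exp (x ^ 2 / 4)) (gaussianReal 0 1) := by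
  rw [gaussianReal_of_var_ne_zero 0 one_ne_zero,
    integrable_withDensity_iff_integrable_smul' (measurable_gaussianPDF 0 1)
      (Eventually.of_forall fun x => gaussianPDF_lt_top)]
  have h := (integrable_exp_neg_mul_sq (b := 1 / 4) (by norm_num)).const_mul
    ((Real.sqrt (2 * Real.pi * (1 : NNReal)))⁻¹)
  refine h.congr (Eventually.of_forall fun x => ?_)
  simp only [toReal_gaussianPDF, gaussianPDFReal, smul_eq_mul]
  rw [mul_assoc _ (Real.exp (-(x - 0) ^ 2 / (2 * ((1 : NNReal) : ℝ)))) _, ← Real.exp_add]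
  congr 2
  simp
  ring

/-- The exponential moment constant. -/
def B₀ : ℝ := ∫ x, Real.exp (x ^ 2 / 4) ∂(gaussianReal 0 1)

lemma exp_quad_bound (x : ℝ) : Real.exp x ≤ 1 + x + x ^ 2 * Real.exp |x| := by
  have h := Complex.norm_exp_sub_sum_le_norm_mul_exp (x : ℂ) 2
  have e : Complex.exp (x : ℂ) - ∑ m ∈ Finset.range 2, (x : ℂ) ^ m / (m.factorial : ℂ) =
      ((Real.exp x - (1 + x) : ℝ) : ℂ) := by
    simp [Finset.sum_range_succ]
  rw [e, Complex.norm_real, Complex.norm_real, Real.norm_eq_abs, Real.norm_eq_abs, sq_abs] at h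
  linarith [le_abs_self (Real.exp x - (1 + x))]

/-- Bernstein / Chernoff bound for i.i.d. samples. -/
lemma bernstein_iid {s B δ : ℝ} (hs : 0 < s) (hB : 0 < B) (hδ : 0 < δ) :
    ∃ c, 0 < c ∧ ∀ (Ω : Type) [MeasurableSpace Ω] (p : ℕ) (μ : Measure Ω) [IsProbabilityMeasure μ] (X : Ω → ℝ) (m : ℝ),
      Measurable X → Integrable (fun ω => Real.exp (s * |X ω|)) μ →
      ∫ ω, Real.exp (s * |X ω|) ∂μ ≤ B → ∫ ω, X ω ∂μ ≤ m →
      (Measure.pi fun _ : Fin p => μ) {V | (m + δ) * p ≤ ∑ k, X (V k)} ≤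
        ENNReal.ofReal (Real.exp (-c * p)) := by
  set l := min (s / 2) (δ * s ^ 2 / (16 * B)) with hl
  have l0 : 0 < l := lt_min (by positivity) (by positivity)
  refine ⟨l * δ / 2, by positivity, ?_⟩
  intro Ω _ p μ _ X m hX hInt hle hm
  have l1 : l ≤ s / 2 := min_le_left _ _
  have l2 : l * (16 * B) ≤ δ * s ^ 2 := (le_div_iff₀ (by positivity)).1 (min_le_right _ _)
  have hXi : Integrable X μ := by
    refine Integrable.mono' (hInt.const_mul s⁻¹) hX.aestronglyMeasurable
      (Eventually.of_forall fun ω => ?_)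
    have := Real.add_one_le_exp (s * |X ω|)
    rw [Real.norm_eq_abs, ← div_eq_inv_mul, le_div_iff₀ hs]
    linarith
  have ptw : ∀ ω, Real.exp (l * X ω) ≤
      1 + l * X ω + l ^ 2 * (8 / s ^ 2) * Real.exp (s * |X ω|) := by
    intro ω
    refine (exp_quad_bound _).trans (add_le_add le_rfl ?_)
    have h1 : |l * X ω| ≤ s * |X ω| / 2 := by
      rw [abs_mul, abs_of_pos l0]
      have := mul_le_mul_of_nonneg_right l1 (abs_nonneg (X ω))
      linarith
    have h2 : Real.exp |l * X ω| ≤ Real.exp (s * |X ω| / 2) := Real.exp_le_exp.2 h1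
    have h3 : (X ω) ^ 2 ≤ 8 / s ^ 2 * Real.exp (s * |X ω| / 2) := by
      have := Real.quadratic_le_exp_of_nonneg (x := s * |X ω| / 2) (by positivity)
      rw [div_mul_eq_mul_div, le_div_iff₀ (by positivity)]
      have e : (s * |X ω| / 2) ^ 2 = s ^ 2 * (X ω) ^ 2 / 4 := by
        rw [div_pow, mul_pow, sq_abs]; ring
      rw [e] at this
      have : 0 ≤ s * |X ω| / 2 := by positivity
      linarith
    have h4 : Real.exp (s * |X ω|) = Real.exp (s * |X ω| / 2) * Real.exp (s * |X ω| / 2) := by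
      rw [← Real.exp_add]; congr 1; ring
    calc (l * X ω) ^ 2 * Real.exp |l * X ω| = l ^ 2 * ((X ω) ^ 2 * Real.exp |l * X ω|) := by ring
      _ ≤ l ^ 2 * ((8 / s ^ 2 * Real.exp (s * |X ω| / 2)) * Real.exp (s * |X ω| / 2)) := by
          refine mul_le_mul_of_nonneg_left ?_ (by positivity)
          exact mul_le_mul h3 h2 (by positivity) (by positivity)
      _ = _ := by rw [h4]; ring
  have i0 : Integrable (fun ω => 1 + l * X ω) μ := (integrable_const _).add (hXi.const_mul l)
  have i1 : Integrable (fun ω => l ^ 2 * (8 / s ^ 2) * Real.exp (s * |X ω|)) μ := hInt.const_mul _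
  have hexp : Integrable (fun ω => Real.exp (l * X ω)) μ :=
    Integrable.mono' (i0.add i1) (by fun_prop) (Eventually.of_forall fun ω => by
      rw [Real.norm_eq_abs, abs_of_pos (Real.exp_pos _)]; exact ptw ω)
  have hmgf : ∫ ω, Real.exp (l * X ω) ∂μ ≤ Real.exp (l * (m + δ / 2)) := by
    calc _ ≤ ∫ ω, ((1 + l * X ω) + l ^ 2 * (8 / s ^ 2) * Real.exp (s * |X ω|)) ∂μ :=
          integral_mono hexp (i0.add i1) ptw
      _ = 1 + l * ∫ ω, X ω ∂μ + l ^ 2 * (8 / s ^ 2) * ∫ ω, Real.exp (s * |X ω|) ∂μ := by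
          rw [integral_add i0 i1, integral_add (integrable_const _) (hXi.const_mul l),
            integral_const_mul, integral_const_mul]
          simp
      _ ≤ 1 + l * m + l ^ 2 * (8 / s ^ 2) * B :=
          add_le_add (add_le_add le_rfl (mul_le_mul_of_nonneg_left hm l0.le))
            (mul_le_mul_of_nonneg_left hle (by positivity))
      _ ≤ l * (m + δ / 2) + 1 := by
          have : l ^ 2 * (8 / s ^ 2) * B ≤ l * (δ / 2) := by
            have e : l ^ 2 * (8 / s ^ 2) * B = l * (l * (16 * B)) / (2 * s ^ 2) := by
              field_simp; ring
            rw [e, div_le_iff₀ (by positivity)]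
            have := mul_le_mul_of_nonneg_left l2 l0.le
            linarith
          linarith
      _ ≤ _ := Real.add_one_le_exp _
  have hprod : ∀ V : Fin p → Ω, Real.exp (l * ∑ k, X (V k)) = ∏ k, Real.exp (l * X (V k)) := by
    intro V; rw [Finset.mul_sum, Real.exp_sum]
  have hint2 : Integrable (fun V : Fin p → Ω => Real.exp (l * ∑ k, X (V k)))
      (Measure.pi fun _ : Fin p => μ) := by
    simp_rw [hprod]
    exact Integrable.fintype_prod (f := fun _ ω => Real.exp (l * X ω)) (fun _ => hexp)
  have hmg : mgf (fun V : Fin p → Ω => ∑ k, X (V k)) (Measure.pi fun _ : Fin p => μ) l =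
      (∫ ω, Real.exp (l * X ω) ∂μ) ^ p := by
    unfold mgf
    simp_rw [hprod]
    rw [integral_fintype_prod_eq_pow (fun ω => Real.exp (l * X ω)), Fintype.card_fin]
  have hch := measure_ge_le_exp_mul_mgf (μ := Measure.pi fun _ : Fin p => μ)
    (X := fun V : Fin p → Ω => ∑ k, X (V k)) ((m + δ) * p) l0.le hint2
  rw [hmg] at hch
  have hfin : (Measure.pi fun _ : Fin p => μ).real {V | (m + δ) * p ≤ ∑ k, X (V k)} ≤
      Real.exp (-(l * δ / 2) * p) := by
    refine hch.trans ?_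
    calc _ ≤ Real.exp (-l * ((m + δ) * p)) * (Real.exp (l * (m + δ / 2))) ^ p := by
          refine mul_le_mul_of_nonneg_left ?_ (Real.exp_pos _).le
          exact pow_le_pow_left₀ (integral_nonneg fun _ => (Real.exp_pos _).le) hmgf p
      _ = _ := by
          rw [← Real.exp_nat_mul, ← Real.exp_add]; congr 1; ring
  rw [← ENNReal.ofReal_toReal (measure_ne_top (Measure.pi fun _ : Fin p => μ) _)]
  exact ENNReal.ofReal_le_ofReal hfin

lemma gauss_conc {C δ : ℝ} (hC : 0 < C) (hδ : 0 < δ) :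
    ∃ c, 0 < c ∧ ∀ (d p : ℕ), 0 < d → ∀ (a b u : Fin d → ℝ), eNorm a = Real.sqrt d →
      eNorm b = Real.sqrt d → eNorm u = Real.sqrt d → ∀ (X : (Fin d → ℝ) → ℝ) (m : ℝ),
      Measurable X →
      (∀ v, |X v| ≤ C * (1 + (dotp v a) ^ 2 + (dotp v b) ^ 2 + (dotp v u) ^ 2)) →
      ∫ v, X v ∂(gv d) ≤ m →
      (gaussianMatrix p d) {V | (m + δ) * p ≤ ∑ k, X (V k)} ≤
        ENNReal.ofReal (Real.exp (-c * p)) := by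
  have hB0 : 0 ≤ B₀ := integral_nonneg fun _ => (Real.exp_pos _).le
  set s : ℝ := 1 / (12 * C) with hs
  have s0 : 0 < s := by positivity
  set B : ℝ := Real.exp (1 / 12) * (B₀ + B₀ + B₀) + 1 with hB
  have hBpos : 0 < B := by positivity
  obtain ⟨c, c0, hc⟩ := bernstein_iid s0 hBpos hδ
  refine ⟨c, c0, ?_⟩
  intro d p hd a b u ha hb hu X m hX hbd hm
  have hm1 : Measurable fun x : ℝ => Real.exp (x ^ 2 / 4) := by fun_prop
  have hi : ∀ w : Fin d → ℝ, eNorm w = Real.sqrt d →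
      Integrable (fun v => Real.exp ((dotp v w) ^ 2 / 4)) (gv d) := by
    intro w hw
    have h := exp_sq_integrable
    rw [← gv_law hd w hw] at h
    exact h.comp_measurable (measurable_dotp w)
  have he : ∀ w : Fin d → ℝ, eNorm w = Real.sqrt d →
      ∫ v, Real.exp ((dotp v w) ^ 2 / 4) ∂(gv d) = B₀ := fun w hw =>
    gv_integral_comp hd w hw hm1
  have ptw : ∀ v, Real.exp (s * |X v|) ≤ Real.exp (1 / 12) *
      (Real.exp ((dotp v a) ^ 2 / 4) + Real.exp ((dotp v b) ^ 2 / 4) +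
        Real.exp ((dotp v u) ^ 2 / 4)) := by
    intro v
    have h1 : s * |X v| ≤ 1 / 12 + ((dotp v a) ^ 2 + (dotp v b) ^ 2 + (dotp v u) ^ 2) / 12 := by
      have := mul_le_mul_of_nonneg_left (hbd v) s0.le
      refine this.trans (le_of_eq ?_)
      rw [hs]; field_simp; ring
    have h2 : ∀ α β γ : ℝ, Real.exp ((α + β + γ) / 12) ≤
        Real.exp (α / 4) + Real.exp (β / 4) + Real.exp (γ / 4) := by
      intro α β γ
      have pa := Real.exp_pos (α / 4)
      have pb := Real.exp_pos (β / 4)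
      have pc := Real.exp_pos (γ / 4)
      have : (α + β + γ) / 12 ≤ α / 4 ∨ (α + β + γ) / 12 ≤ β / 4 ∨ (α + β + γ) / 12 ≤ γ / 4 := by
        by_contra! h
        linarith [h.1, h.2.1, h.2.2]
      rcases this with h | h | h <;> have := Real.exp_le_exp.2 h <;> linarith
    calc _ ≤ Real.exp (1 / 12 + ((dotp v a) ^ 2 + (dotp v b) ^ 2 + (dotp v u) ^ 2) / 12) :=
          Real.exp_le_exp.2 h1
      _ ≤ _ := by
          rw [Real.exp_add]
          exact mul_le_mul_of_nonneg_left (h2 _ _ _) (Real.exp_pos _).le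
  have hI := (((hi a ha).add (hi b hb)).add (hi u hu)).const_mul (Real.exp (1 / 12))
  have hInt : Integrable (fun v => Real.exp (s * |X v|)) (gv d) :=
    Integrable.mono' hI (by fun_prop) (Eventually.of_forall fun ω => by
      rw [Real.norm_eq_abs, abs_of_pos (Real.exp_pos _)]; exact ptw ω)
  refine hc _ p (gv d) X m hX hInt ?_ hm
  refine (integral_mono hInt hI ptw).trans ?_
  have : ∫ v, Real.exp (1 / 12) *
      (Real.exp ((dotp v a) ^ 2 / 4) + Real.exp ((dotp v b) ^ 2 / 4) +
        Real.exp ((dotp v u) ^ 2 / 4)) ∂(gv d) = Real.exp (1 / 12) * (B₀ + B₀ + B₀) := by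
    have i2 : Integrable (fun v => Real.exp ((dotp v a) ^ 2 / 4) +
        Real.exp ((dotp v b) ^ 2 / 4)) (gv d) := (hi a ha).add (hi b hb)
    rw [integral_const_mul, integral_add i2 (hi u hu),
      integral_add (hi a ha) (hi b hb), he a ha, he b hb, he u hu]
  refine (le_of_eq this).trans ?_
  rw [hB]; linarith


/-! ## Part 5: expectations -/

lemma gauss_int {f : ℝ → ℝ} (hf : Measurable f) {C : ℝ} (h : ∀ x, |f x| ≤ C * (1 + x ^ 2)) :
    Integrable f (gaussianReal 0 1) := by
  have h2 : Integrable (fun x : ℝ => x ^ 2) (gaussianReal 0 1) :=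
    (memLp_id_gaussianReal (μ := 0) (v := 1) 2).integrable_sq
  exact Integrable.mono' (((integrable_const (1:ℝ)).add h2).const_mul C)
    hf.aestronglyMeasurable (Eventually.of_forall h)

lemma gauss_pos {f : ℝ → ℝ} (hf : Continuous f) (hi : Integrable f (gaussianReal 0 1))
    (h0 : ∀ x, 0 ≤ f x) {x : ℝ} (hx : f x ≠ 0) : 0 < ∫ g, f g ∂(gaussianReal 0 1) := by
  haveI : (gaussianReal 0 1).IsOpenPosMeasure :=
    (gaussianReal_absolutelyContinuous' 0 (one_ne_zero)).isOpenPosMeasure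
  exact integral_pos_of_integrable_nonneg_nonzero hf hi h0 hx

lemma indep3 {d : ℕ} {a b w : Fin d → ℝ} (hab : dotp a b = 0) (haw : dotp a w = 0)
    (hbw : dotp b w = 0) {f : ℝ × ℝ → ℝ} (hf : Measurable f) {g : ℝ → ℝ} (hg : Measurable g) :
    ∫ v, f (dotp v a, dotp v b) * g (dotp v w) ∂(gv d) =
      (∫ v, f (dotp v a, dotp v b) ∂(gv d)) * ∫ v, g (dotp v w) ∂(gv d) := by
  have hI := gv_indep ![a, b, w] (by
    intro i j hij
    fin_cases i <;> fin_cases j <;> simp_all [dotp_comm b a, dotp_comm w a, dotp_comm w b])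
  have h := hI.indepFun_prodMk (fun i => measurable_dotp _) 0 1 2 (by decide) (by decide)
  have h2 := h.comp hf hg
  exact h2.integral_fun_mul_eq_mul_integral
    (hf.comp ((measurable_dotp a).prodMk (measurable_dotp b))).aestronglyMeasurable
    (hg.comp (measurable_dotp w)).aestronglyMeasurable

lemma indep2 {d : ℕ} {a w : Fin d → ℝ} (haw : dotp a w = 0)
    {f : ℝ → ℝ} (hf : Measurable f) {g : ℝ → ℝ} (hg : Measurable g) :
    ∫ v, f (dotp v a) * g (dotp v w) ∂(gv d) =
      (∫ v, f (dotp v a) ∂(gv d)) * ∫ v, g (dotp v w) ∂(gv d) :=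
  indep3 (a := a) (b := 0) (w := w) (by simp [dotp]) haw (by simp [dotp])
    (f := fun x => f x.1) (hf.comp measurable_fst) hg

lemma Smooth.cont {φ : ℝ → ℝ} {L : ℝ} (h : Smooth φ L) : Continuous φ := h.diff.continuous

lemma Smooth.dcont {φ : ℝ → ℝ} {L : ℝ} (h : Smooth φ L) : Continuous (deriv φ) := by
  have : LipschitzWith (Real.toNNReal L) (deriv φ) := by
    apply LipschitzWith.of_dist_le_mul
    intro a b
    rw [Real.dist_eq, Real.dist_eq, Real.coe_toNNReal _ h.pos.le]
    exact h.dlip a b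
  exact this.continuous

lemma Smooth.lin_bd {φ : ℝ → ℝ} {L : ℝ} (h : Smooth φ L) (x : ℝ) : |φ x| ≤ |φ 0| + L * |x| := by
  have := h.lip x 0
  rw [sub_zero] at this
  calc |φ x| = |φ 0 + (φ x - φ 0)| := by congr 1; ring
    _ ≤ _ := (abs_add_le _ _).trans (by linarith)

/-- A uniform constant for linear growth. -/
def KL (φ : ℝ → ℝ) (L : ℝ) : ℝ := |φ 0| + L + |hermiteCoeff φ 1| + 1

lemma KL_one {φ : ℝ → ℝ} {L : ℝ} (h : Smooth φ L) : 1 ≤ KL φ L := by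
  unfold KL; linarith [abs_nonneg (φ 0), h.pos, abs_nonneg (hermiteCoeff φ 1)]

lemma KL_L {φ : ℝ → ℝ} {L : ℝ} : L ≤ KL φ L := by
  unfold KL; linarith [abs_nonneg (φ 0), abs_nonneg (hermiteCoeff φ 1)]

lemma bd_phi {φ : ℝ → ℝ} {L : ℝ} (h : Smooth φ L) (x : ℝ) : |φ x| ≤ KL φ L * (1 + |x|) := by
  have := h.lin_bd x
  have h1 : KL φ L * (1 + |x|) = |φ 0| + L * |x| + (|φ 0| * |x| + L +
    (|hermiteCoeff φ 1| + 1) * (1 + |x|)) := by unfold KL; ring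
  have := h.pos
  have : 0 ≤ (|φ 0| * |x| + L + (|hermiteCoeff φ 1| + 1) * (1 + |x|)) := by positivity
  linarith

lemma bd_tphi {φ : ℝ → ℝ} {L : ℝ} (h : Smooth φ L) (x : ℝ) :
    |φ x - hermiteCoeff φ 1 * x| ≤ KL φ L * (1 + |x|) := by
  have h0 := h.lin_bd x
  have h2 : |φ x - hermiteCoeff φ 1 * x| ≤ |φ x| + |hermiteCoeff φ 1| * |x| := by
    rw [← abs_mul]; exact abs_sub _ _
  have h1 : KL φ L * (1 + |x|) = |φ 0| + L * |x| + |hermiteCoeff φ 1| * |x| + (|φ 0| * |x| + L +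
    (|hermiteCoeff φ 1|) + (1 + |x|)) := by unfold KL; ring
  have := h.pos
  have : 0 ≤ (|φ 0| * |x| + L + |hermiteCoeff φ 1| + (1 + |x|)) := by positivity
  linarith

/-- Measurable bounded by linear: product bound helper. -/
lemma prod_bd {A B K x y : ℝ} (hK : 1 ≤ K) (hA : |A| ≤ K * (1 + |x|)) (hB : |B| ≤ K * (1 + |y|)) :
    |A * B| ≤ 4 * K ^ 2 * (1 + x ^ 2 + y ^ 2) := by
  rw [abs_mul]
  have hx := abs_nonneg x
  have hy := abs_nonneg y
  calc |A| * |B| ≤ (K * (1 + |x|)) * (K * (1 + |y|)) :=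
        mul_le_mul hA hB (abs_nonneg _) (by positivity)
    _ = K ^ 2 * ((1 + |x|) * (1 + |y|)) := by ring
    _ ≤ K ^ 2 * (4 * (1 + x ^ 2 + y ^ 2)) := by
        refine mul_le_mul_of_nonneg_left ?_ (by positivity)
        rw [← sq_abs x, ← sq_abs y]
        nlinarith [sq_nonneg (|x| - 1), sq_nonneg (|y| - 1), sq_nonneg (|x| - |y|)]
    _ = _ := by ring

lemma herm_zero (φ : ℝ → ℝ) : hermiteCoeff φ 0 = ∫ g, φ g ∂(gaussianReal 0 1) := by
  simp [hermiteCoeff, hermiteFn]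

lemma herm_one (φ : ℝ → ℝ) : hermiteCoeff φ 1 = ∫ g, φ g * g ∂(gaussianReal 0 1) := by
  simp [hermiteCoeff, hermiteFn]

lemma gauss_sq : ∫ g, g ^ 2 ∂(gaussianReal 0 1) = 1 := by
  have h := variance_fun_id_gaussianReal (μ := 0) (v := 1)
  rw [variance_of_integral_eq_zero (by fun_prop) (by simp)] at h
  simpa using h

lemma tphi_mean {φ : ℝ → ℝ} {L : ℝ} (h : Smooth φ L) (h0 : hermiteCoeff φ 0 = 0) :
    ∫ g, (φ g - hermiteCoeff φ 1 * g) ∂(gaussianReal 0 1) = 0 := by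
  have i1 : Integrable φ (gaussianReal 0 1) := by
    refine gauss_int h.cont.measurable (C := 4 * KL φ L ^ 2) fun x => ?_
    have := prod_bd (A := φ x) (B := 1) (y := 0) (KL_one h) (bd_phi h x) (by simpa using KL_one h)
    simpa using this
  have i2 : Integrable (fun x : ℝ => x) (gaussianReal 0 1) :=
    gauss_int measurable_id (C := 1) fun x => by
      rw [← sq_abs]; nlinarith [sq_nonneg (|x| - 1)]
  rw [integral_sub i1 (i2.const_mul _), ← herm_zero, h0, integral_const_mul]
  simp

lemma tphi_mul {φ : ℝ → ℝ} {L : ℝ} (h : Smooth φ L) :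
    ∫ g, (φ g - hermiteCoeff φ 1 * g) * g ∂(gaussianReal 0 1) = 0 := by
  have i1 : Integrable (fun x => φ x * x) (gaussianReal 0 1) := by
    refine gauss_int (h.cont.measurable.mul measurable_id) (C := 8 * KL φ L ^ 2) fun x => ?_
    have := prod_bd (A := φ x) (B := x) (y := x) (KL_one h) (bd_phi h x)
      (by nlinarith [KL_one h, abs_nonneg x])
    have := sq_nonneg (KL φ L)
    nlinarith
  have i2 : Integrable (fun x : ℝ => x ^ 2) (gaussianReal 0 1) :=
    gauss_int (by fun_prop) (C := 1) fun x => by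
      rw [abs_of_nonneg (by positivity)]; linarith
  have : ∀ g, (φ g - hermiteCoeff φ 1 * g) * g = φ g * g - hermiteCoeff φ 1 * g ^ 2 := by
    intro g; ring
  simp_rw [this]
  rw [integral_sub i1 (i2.const_mul _), ← herm_one, integral_const_mul, gauss_sq]
  simp

/-- choice of `M`. -/
lemma exists_M {ε : ℝ} (hε : 0 < ε) : ∃ M : ℝ, 0 ≤ M ∧
    ∫ g, (max (|g| - M) 0) ^ 2 ∂(gaussianReal 0 1) ≤ ε := by
  have h2 : Integrable (fun x : ℝ => x ^ 2) (gaussianReal 0 1) :=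
    gauss_int (by fun_prop) (C := 1) fun x => by
      rw [abs_of_nonneg (by positivity)]; linarith
  have ht : Tendsto (fun n : ℕ => ∫ g, (max (|g| - (n : ℝ)) 0) ^ 2 ∂(gaussianReal 0 1)) atTop
      (nhds (∫ _g, (0 : ℝ) ∂(gaussianReal 0 1))) := by
    refine tendsto_integral_of_dominated_convergence (fun x => x ^ 2) ?_ h2 ?_ ?_
    · intro n
      have : Continuous fun g : ℝ => (max (|g| - (n : ℝ)) 0) ^ 2 := by fun_prop
      exact this.aestronglyMeasurable
    · intro n
      refine Eventually.of_forall fun x => ?_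
      rw [Real.norm_eq_abs, abs_of_nonneg (by positivity), ← sq_abs x]
      apply pow_le_pow_left₀ (le_max_right _ _)
      apply max_le _ (abs_nonneg _)
      have : (0 : ℝ) ≤ n := by positivity
      linarith
    · refine Eventually.of_forall fun x => ?_
      obtain ⟨n0, hn0⟩ := exists_nat_ge |x|
      refine tendsto_const_nhds.congr' ?_
      filter_upwards [eventually_ge_atTop n0] with n hn
      have : (n0 : ℝ) ≤ n := by exact_mod_cast hn
      rw [max_eq_right (by linarith)]
      simp
  rw [integral_zero] at ht
  obtain ⟨n, hn⟩ := (ht.eventually (eventually_le_nhds hε)).exists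
  exact ⟨n, by positivity, hn⟩

/-- Positivity constants. -/
lemma pos_consts {φ : ℝ → ℝ} {L : ℝ} (h : Smooth φ L) (hn : ¬ ∃ a b : ℝ, ∀ z, φ z = a * z + b) :
    0 < ∫ g, φ g ^ 2 ∂(gaussianReal 0 1) ∧ 0 < ∫ g, deriv φ g ^ 2 ∂(gaussianReal 0 1) ∧
    0 < ∫ g, deriv φ g ^ 2 * g ^ 2 ∂(gaussianReal 0 1) := by
  have hφ0 : ∃ x, φ x ≠ 0 := by
    by_contra! hc
    exact hn ⟨0, 0, fun z => by simp [hc z]⟩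
  have hd0 : ∃ x, x ≠ 0 ∧ deriv φ x ≠ 0 := by
    by_contra! hc
    have hz : deriv φ 0 = 0 := by
      have hcl : IsClosed {x | deriv φ x = 0} := isClosed_eq h.dcont continuous_const
      have hsub : closure ({0}ᶜ : Set ℝ) ⊆ {x | deriv φ x = 0} :=
        closure_minimal (fun x hx => hc x hx) hcl
      have : (0 : ℝ) ∈ closure ({0}ᶜ : Set ℝ) := by
        rw [(dense_compl_singleton (0 : ℝ)).closure_eq]; trivial
      exact hsub this
    have hall : ∀ x, deriv φ x = 0 := by
      intro x
      by_cases hx : x = 0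
      · rw [hx, hz]
      · exact hc x hx
    exact hn ⟨0, φ 0, fun z => by
      rw [is_const_of_deriv_eq_zero h.diff hall z 0]; ring⟩
  have hL := h.pos
  have hbd2 : ∀ x, deriv φ x ^ 2 ≤ L ^ 2 := fun x => by
    rw [← sq_abs]; exact pow_le_pow_left₀ (abs_nonneg _) (h.bd x) 2
  refine ⟨?_, ?_, ?_⟩
  · obtain ⟨x, hx⟩ := hφ0
    refine gauss_pos (h.cont.pow 2) (gauss_int (h.cont.pow 2).measurable (C := 8 * KL φ L ^ 2)
      fun y => ?_) (fun y => by positivity) (x := x) (by positivity)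
    have := prod_bd (KL_one h) (bd_phi h y) (bd_phi h y)
    rw [← sq] at this
    have := sq_nonneg (KL φ L)
    nlinarith
  · obtain ⟨x, _, hx⟩ := hd0
    refine gauss_pos (h.dcont.pow 2) (gauss_int (h.dcont.pow 2).measurable (C := L ^ 2)
      fun y => ?_) (fun y => by positivity) (x := x) (by positivity)
    rw [abs_of_nonneg (by positivity)]
    nlinarith [hbd2 y, mul_nonneg (sq_nonneg L) (sq_nonneg y)]
  · obtain ⟨x, hx0, hx⟩ := hd0
    have hc : Continuous fun y => deriv φ y ^ 2 * y ^ 2 := (h.dcont.pow 2).mul (continuous_pow 2)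
    refine gauss_pos hc (gauss_int hc.measurable (C := L ^ 2)
      fun y => ?_) (fun y => by positivity) (x := x) (by positivity)
    rw [abs_of_nonneg (by positivity)]
    nlinarith [mul_le_mul_of_nonneg_right (hbd2 y) (sq_nonneg y), sq_nonneg L]


/-! ## Part 6: expectations of the six statistics -/

lemma dotp_self_eq {d : ℕ} {u : Fin d → ℝ} (hu : eNorm u = Real.sqrt d) : dotp u u = d := by
  rw [← eNorm_sq', hu, Real.sq_sqrt (by positivity)]

lemma int2 {d : ℕ} (a b c : Fin d → ℝ) {F : ℝ → ℝ → ℝ → ℝ}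
    (hF : Measurable fun x : ℝ × ℝ × ℝ => F x.1 x.2.1 x.2.2) {C : ℝ}
    (h : ∀ x y z, |F x y z| ≤ C * (1 + x ^ 2 + y ^ 2 + z ^ 2)) :
    Integrable (fun v => F (dotp v a) (dotp v b) (dotp v c)) (gv d) :=
  gv_integrable a b c (hF.comp ((measurable_dotp a).prodMk
    ((measurable_dotp b).prodMk (measurable_dotp c)))) (fun v => h _ _ _)

lemma exp_D {d : ℕ} (hd : 0 < d) {φ : ℝ → ℝ} {L : ℝ} (h : Smooth φ L) {z u : Fin d → ℝ}
    (hz : eNorm z = Real.sqrt d) (hu : eNorm u = Real.sqrt d) {c : ℝ}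
    (h1 : c ≤ ∫ g, deriv φ g ^ 2 ∂(gaussianReal 0 1))
    (h2 : c ≤ ∫ g, deriv φ g ^ 2 * g ^ 2 ∂(gaussianReal 0 1)) :
    c ≤ ∫ v, (deriv φ (dotp v z) * dotp v u) ^ 2 ∂(gv d) := by
  have hd' : (d : ℝ) ≠ 0 := by positivity
  have hdm := h.dcont.measurable
  set α := dotp z u / d with hα
  set w := u - α • z with hw
  have zz := dotp_self_eq hz
  have uu := dotp_self_eq hu
  have zw : dotp z w = 0 := by
    rw [hw, dotp_sub, dotp_smul, zz, hα]; field_simp; ring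
  have ww : dotp w w / d = 1 - α ^ 2 := by
    have e1 : dotp w w = dotp u w - α * dotp z w := by rw [hw, sub_dotp, smul_dotp]
    have e2 : dotp z u = α * d := by rw [hα]; field_simp
    rw [e1, zw, hw, dotp_sub, dotp_smul, uu, dotp_comm u z, e2]
    field_simp
    ring
  have ww0 : 0 ≤ 1 - α ^ 2 := by
    rw [← ww, ← eNorm_sq']; positivity
  have hvu : ∀ v, dotp v u = α * dotp v z + dotp v w := by
    intro v; rw [hw, dotp_sub, dotp_smul]; ring
  have hbd2 : ∀ x, deriv φ x ^ 2 ≤ L ^ 2 := fun x => by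
    rw [← sq_abs]; exact pow_le_pow_left₀ (abs_nonneg _) (h.bd x) 2
  have e : ∀ v, (deriv φ (dotp v z) * dotp v u) ^ 2 =
      α ^ 2 * (deriv φ (dotp v z) ^ 2 * (dotp v z) ^ 2) +
      2 * α * ((deriv φ (dotp v z) ^ 2 * dotp v z) * dotp v w) +
      deriv φ (dotp v z) ^ 2 * (dotp v w) ^ 2 := by
    intro v; rw [hvu]; ring
  have i1 : Integrable (fun v => deriv φ (dotp v z) ^ 2 * (dotp v z) ^ 2) (gv d) := by
    refine int2 z z z (F := fun x _ _ => deriv φ x ^ 2 * x ^ 2) (by fun_prop) (C := L ^ 2) ?_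
    intro x y z
    rw [abs_of_nonneg (by positivity)]
    nlinarith [mul_le_mul_of_nonneg_right (hbd2 x) (sq_nonneg x), sq_nonneg L,
      mul_nonneg (sq_nonneg L) (sq_nonneg y), mul_nonneg (sq_nonneg L) (sq_nonneg z)]
  have i2 : Integrable (fun v => (deriv φ (dotp v z) ^ 2 * dotp v z) * dotp v w) (gv d) := by
    refine int2 z w z (F := fun x y _ => (deriv φ x ^ 2 * x) * y) (by fun_prop) (C := L ^ 2) ?_
    intro x y z
    rw [mul_assoc, abs_mul, abs_of_nonneg (by positivity)]
    have : |x * y| ≤ 1 + x ^ 2 + y ^ 2 + z ^ 2 := by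
      rw [abs_mul, ← sq_abs x, ← sq_abs y]
      nlinarith [sq_nonneg (|x| - |y|), sq_nonneg z]
    exact mul_le_mul (hbd2 x) this (abs_nonneg _) (by positivity)
  have i3 : Integrable (fun v => deriv φ (dotp v z) ^ 2 * (dotp v w) ^ 2) (gv d) := by
    refine int2 z w z (F := fun x y _ => deriv φ x ^ 2 * y ^ 2) (by fun_prop) (C := L ^ 2) ?_
    intro x y z
    rw [abs_of_nonneg (by positivity)]
    nlinarith [mul_le_mul_of_nonneg_right (hbd2 x) (sq_nonneg y), sq_nonneg L,
      mul_nonneg (sq_nonneg L) (sq_nonneg x), mul_nonneg (sq_nonneg L) (sq_nonneg z)]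
  simp_rw [e]
  have i12 : Integrable (fun v => α ^ 2 * (deriv φ (dotp v z) ^ 2 * (dotp v z) ^ 2) +
      2 * α * ((deriv φ (dotp v z) ^ 2 * dotp v z) * dotp v w)) (gv d) :=
    (i1.const_mul _).add (i2.const_mul _)
  rw [integral_add i12 i3, integral_add (i1.const_mul _) (i2.const_mul _), integral_const_mul,
    integral_const_mul, indep2 zw (f := fun x => deriv φ x ^ 2 * x) (g := fun y => y)
      (by fun_prop) measurable_id, gv_mean,
    indep2 zw (f := fun x => deriv φ x ^ 2) (g := fun y => y ^ 2) (by fun_prop) (by fun_prop),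
    gv_sq, ww, gv_integral_comp hd z hz (f := fun x => deriv φ x ^ 2) (by fun_prop),
    gv_integral_comp hd z hz (f := fun x => deriv φ x ^ 2 * x ^ 2) (by fun_prop)]
  nlinarith [mul_le_mul_of_nonneg_left h2 (sq_nonneg α), mul_le_mul_of_nonneg_left h1 ww0]

/-- The constant `κ`. -/
def kap (φ : ℝ → ℝ) : ℝ := ∫ g, φ g * deriv φ g * g ∂(gaussianReal 0 1)

lemma exp_E {d : ℕ} (hd : 0 < d) {φ : ℝ → ℝ} {L : ℝ} (h : Smooth φ L) {z u : Fin d → ℝ}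
    (hz : eNorm z = Real.sqrt d) :
    ∫ v, φ (dotp v z) * (deriv φ (dotp v z) * dotp v u) ∂(gv d) = kap φ * (dotp z u / d) := by
  have hd' : (d : ℝ) ≠ 0 := by positivity
  have hdm := h.dcont.measurable
  have hm := h.cont.measurable
  set α := dotp z u / d with hα
  set w := u - α • z with hw
  have zz := dotp_self_eq hz
  have zw : dotp z w = 0 := by
    rw [hw, dotp_sub, dotp_smul, zz, hα]; field_simp; ring
  have hvu : ∀ v, dotp v u = α * dotp v z + dotp v w := by
    intro v; rw [hw, dotp_sub, dotp_smul]; ring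
  have e : ∀ v, φ (dotp v z) * (deriv φ (dotp v z) * dotp v u) =
      α * (φ (dotp v z) * deriv φ (dotp v z) * dotp v z) +
      (φ (dotp v z) * deriv φ (dotp v z)) * dotp v w := by
    intro v; rw [hvu]; ring
  have K1 := KL_one h
  have B : ∀ x y, |φ x * deriv φ x * y| ≤ L * (4 * KL φ L ^ 2 * (1 + x ^ 2 + y ^ 2)) := by
    intro x y
    have := prod_bd (A := φ x) (B := y) (y := y) K1 (bd_phi h x)
      (by nlinarith [KL_one h, abs_nonneg y])
    have e : φ x * deriv φ x * y = deriv φ x * (φ x * y) := by ring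
    rw [e, abs_mul]
    exact mul_le_mul (h.bd x) this (abs_nonneg _) h.pos.le
  have hP : 0 ≤ L * (4 * KL φ L ^ 2) := mul_nonneg h.pos.le (by positivity)
  have i1 : Integrable (fun v => φ (dotp v z) * deriv φ (dotp v z) * dotp v z) (gv d) := by
    refine int2 z z z (F := fun x _ _ => φ x * deriv φ x * x) (by fun_prop)
      (C := 2 * (L * (4 * KL φ L ^ 2))) ?_
    intro x y z
    have := B x x
    nlinarith [mul_nonneg hP (sq_nonneg y), mul_nonneg hP (sq_nonneg z)]
  have i2 : Integrable (fun v => φ (dotp v z) * deriv φ (dotp v z) * dotp v w) (gv d) := by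
    refine int2 z w z (F := fun x y _ => φ x * deriv φ x * y) (by fun_prop)
      (C := (L * (4 * KL φ L ^ 2))) ?_
    intro x y z
    have := B x y
    nlinarith [mul_nonneg hP (sq_nonneg y), mul_nonneg hP (sq_nonneg z)]
  simp_rw [e]
  rw [integral_add (i1.const_mul _) i2, integral_const_mul,
    indep2 zw (f := fun x => φ x * deriv φ x) (g := fun y => y)
      (by fun_prop) measurable_id, gv_mean,
    gv_integral_comp hd z hz (f := fun x => φ x * deriv φ x * x) (by fun_prop)]
  unfold kap; ring

lemma exp_F {d : ℕ} (hd : 0 < d) {φ : ℝ → ℝ} {L : ℝ} (h : Smooth φ L) (h0 : hermiteCoeff φ 0 = 0)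
    {z₁ z₂ u : Fin d → ℝ}
    (hz : eNorm z₁ = Real.sqrt d) (hz2 : eNorm z₂ = Real.sqrt d) (h12 : dotp z₁ z₂ = 0) :
    ∫ v, (φ (dotp v z₂) - hermiteCoeff φ 1 * dotp v z₂) * (deriv φ (dotp v z₁) * dotp v u) ∂(gv d)
      = 0 := by
  have hd' : (d : ℝ) ≠ 0 := by positivity
  have hdm := h.dcont.measurable
  have hm := h.cont.measurable
  set α := dotp z₁ u / d with hα
  set β := dotp z₂ u / d with hβ
  set w := u - α • z₁ - β • z₂ with hw
  have zz := dotp_self_eq hz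
  have zz2 := dotp_self_eq hz2
  have h21 : dotp z₂ z₁ = 0 := by rw [dotp_comm, h12]
  have zw : dotp z₁ w = 0 := by
    rw [hw, dotp_sub, dotp_sub, dotp_smul, dotp_smul, zz, h12, hα]; field_simp; ring
  have zw2 : dotp z₂ w = 0 := by
    rw [hw, dotp_sub, dotp_sub, dotp_smul, dotp_smul, zz2, h21, hβ]; field_simp; ring
  have hvu : ∀ v, dotp v u = α * dotp v z₁ + β * dotp v z₂ + dotp v w := by
    intro v; rw [hw, dotp_sub, dotp_sub, dotp_smul, dotp_smul]; ring
  set t : ℝ → ℝ := fun x => φ x - hermiteCoeff φ 1 * x with ht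
  have htm : Measurable t := by rw [ht]; fun_prop
  have e : ∀ v, (φ (dotp v z₂) - hermiteCoeff φ 1 * dotp v z₂) * (deriv φ (dotp v z₁) * dotp v u) =
      α * (t (dotp v z₂) * (deriv φ (dotp v z₁) * dotp v z₁)) +
      β * ((t (dotp v z₂) * dotp v z₂) * deriv φ (dotp v z₁)) +
      (t (dotp v z₂) * deriv φ (dotp v z₁)) * dotp v w := by
    intro v; rw [hvu, ht]; ring
  have K1 := KL_one h
  have B : ∀ x y r, |t x * (deriv φ r * y)| ≤ L * (4 * KL φ L ^ 2 * (1 + x ^ 2 + y ^ 2)) := by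
    intro x y r
    have := prod_bd (A := t x) (B := y) (y := y) K1 (bd_tphi h x)
      (by nlinarith [KL_one h, abs_nonneg y])
    have e : t x * (deriv φ r * y) = deriv φ r * (t x * y) := by ring
    rw [e, abs_mul]
    exact mul_le_mul (h.bd r) this (abs_nonneg _) h.pos.le
  have hP : 0 ≤ L * (4 * KL φ L ^ 2) := mul_nonneg h.pos.le (by positivity)
  have i1 : Integrable (fun v => t (dotp v z₂) * (deriv φ (dotp v z₁) * dotp v z₁)) (gv d) := by
    refine int2 z₁ z₂ z₁ (F := fun x y _ => t y * (deriv φ x * x)) (by fun_prop)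
      (C := (L * (4 * KL φ L ^ 2))) ?_
    intro x y z
    have := B y x x
    nlinarith [mul_nonneg hP (sq_nonneg y), mul_nonneg hP (sq_nonneg z)]
  have i2 : Integrable (fun v => (t (dotp v z₂) * dotp v z₂) * deriv φ (dotp v z₁)) (gv d) := by
    refine int2 z₁ z₂ z₁ (F := fun x y _ => (t y * y) * deriv φ x) (by fun_prop)
      (C := 2 * (L * (4 * KL φ L ^ 2))) ?_
    intro x y z
    have := B y y x
    have e : (t y * y) * deriv φ x = t y * (deriv φ x * y) := by ring
    rw [e]
    nlinarith [mul_nonneg hP (sq_nonneg y), mul_nonneg hP (sq_nonneg z), mul_nonneg hP (sq_nonneg x)]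
  have i3 : Integrable (fun v => (t (dotp v z₂) * deriv φ (dotp v z₁)) * dotp v w) (gv d) := by
    refine int2 z₁ z₂ w (F := fun x y z => (t y * deriv φ x) * z) (by fun_prop)
      (C := (L * (4 * KL φ L ^ 2))) ?_
    intro x y z
    have := B y z x
    have e : (t y * deriv φ x) * z = t y * (deriv φ x * z) := by ring
    rw [e]
    nlinarith [mul_nonneg hP (sq_nonneg y), mul_nonneg hP (sq_nonneg z), mul_nonneg hP (sq_nonneg x)]
  have i12 : Integrable (fun v => α * (t (dotp v z₂) * (deriv φ (dotp v z₁) * dotp v z₁)) +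
      β * ((t (dotp v z₂) * dotp v z₂) * deriv φ (dotp v z₁))) (gv d) :=
    (i1.const_mul _).add (i2.const_mul _)
  have j1 := tphi_mean h h0
  have j2 := tphi_mul h
  simp_rw [e]
  rw [integral_add i12 i3, integral_add (i1.const_mul _) (i2.const_mul _), integral_const_mul,
    integral_const_mul, indep2 h21 (f := t) (g := fun y => deriv φ y * y) htm (by fun_prop),
    indep2 h21 (f := fun x => t x * x) (g := fun y => deriv φ y) (by fun_prop) (by fun_prop),
    gv_integral_comp hd z₂ hz2 (f := t) htm,
    gv_integral_comp hd z₂ hz2 (f := fun x => t x * x) (by fun_prop),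
    indep3 h21 zw2 zw (f := fun x => t x.1 * deriv φ x.2) (g := fun y => y) (by fun_prop)
      measurable_id, gv_mean, ht, j1, j2]
  ring


/-! ## Part 7: probability of the net event -/

set_option maxHeartbeats 4000000 in
lemma netgood_prob {φ : ℝ → ℝ} {L : ℝ} (h : Smooth φ L) (h0 : hermiteCoeff φ 0 = 0)
    {M δ c₀ c₁ : ℝ} (hM0 : 0 ≤ M) (hδ : 0 < δ) (hc₀ : 0 < c₀) (hc₁ : 0 < c₁)
    (hM : ∫ g, (max (|g| - M) 0) ^ 2 ∂(gaussianReal 0 1) ≤ δ ^ 2 / 2)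
    (hC : 2 * c₀ ≤ ∫ g, φ g ^ 2 ∂(gaussianReal 0 1))
    (hD1 : 2 * c₁ ≤ ∫ g, deriv φ g ^ 2 ∂(gaussianReal 0 1))
    (hD2 : 2 * c₁ ≤ ∫ g, deriv φ g ^ 2 * g ^ 2 ∂(gaussianReal 0 1)) :
    ∃ c, 0 < c ∧ ∀ (d p : ℕ), 0 < d → ∀ (z₁ z₂ : Fin d → ℝ), eNorm z₁ = Real.sqrt d →
      eNorm z₂ = Real.sqrt d → dotp z₁ z₂ = 0 → ∀ N : Finset (Fin d → ℝ),
      (∀ u ∈ N, eNorm u = Real.sqrt d) →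
      (gaussianMatrix p d) {V | ¬ NetGood φ V z₁ z₂ N M δ c₀ c₁ (kap φ)} ≤
        ENNReal.ofReal ((7 * N.card + 1) * Real.exp (-c * p)) := by
  have K1 := KL_one h
  have KL' : L ≤ KL φ L := KL_L
  have hL := h.pos
  have hdm := h.dcont.measurable
  have hm := h.cont.measurable
  set K := KL φ L with hK
  have K0 : 0 < K := by linarith
  set δ₀ : ℝ := min (min 1 (δ ^ 2 / 2)) (min (min c₀ c₁) δ) with hδ₀
  have p1 : δ₀ ≤ 1 := (min_le_left _ _).trans (min_le_left _ _)
  have p2 : δ₀ ≤ δ ^ 2 / 2 := (min_le_left _ _).trans (min_le_right _ _)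
  have p3 : δ₀ ≤ c₀ := (min_le_right _ _).trans ((min_le_left _ _).trans (min_le_left _ _))
  have p4 : δ₀ ≤ c₁ := (min_le_right _ _).trans ((min_le_left _ _).trans (min_le_right _ _))
  have p5 : δ₀ ≤ δ := (min_le_right _ _).trans (min_le_right _ _)
  have p0 : 0 < δ₀ := lt_min (lt_min one_pos (by positivity)) (lt_min (lt_min hc₀ hc₁) hδ)
  obtain ⟨c, c0, hc⟩ := gauss_conc (C := 8 * K ^ 3) (by positivity) p0
  refine ⟨c, c0, ?_⟩
  intro d p hd z₁ z₂ n1 n2 h12 N hN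
  have hp0 : (0 : ℝ) ≤ p := by positivity
  set r := ENNReal.ofReal (Real.exp (-c * p)) with hr
  -- general bound
  have hK3 : K ^ 2 ≤ K ^ 3 := pow_le_pow_right₀ K1 (by norm_num)
  have hK31 : 1 ≤ K ^ 3 := one_le_pow₀ K1
  have bnd : ∀ {y S : ℝ} (C' : ℝ), C' ≤ 8 * K ^ 3 → 0 ≤ S → y ≤ C' * S → y ≤ 8 * K ^ 3 * S := by
    intro y S C' h1 h2 h3
    exact h3.trans (mul_le_mul_of_nonneg_right h1 h2)
  have tst : ∀ u ∈ N, ∀ (X : (Fin d → ℝ) → ℝ) (m t : ℝ), Measurable X →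
      (∀ v, |X v| ≤ 8 * K ^ 3 * (1 + (dotp v z₁) ^ 2 + (dotp v z₂) ^ 2 + (dotp v u) ^ 2)) →
      ∫ v, X v ∂(gv d) ≤ m → m + δ₀ ≤ t →
      (gaussianMatrix p d) {V | t * p ≤ ∑ k, X (V k)} ≤ r := by
    intro u hu X m t hX hb hi hmt
    refine le_trans (measure_mono ?_) (hc d p hd z₁ z₂ u n1 n2 (hN u hu) X m hX hb hi)
    intro V hV
    exact (mul_le_mul_of_nonneg_right hmt hp0).trans hV
  -- C
  have SC : (gaussianMatrix p d) {V | (-c₀) * p ≤ ∑ k, -(φ (dotp (V k) z₁)) ^ 2} ≤ r := by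
    refine le_trans (measure_mono ?_) (hc d p hd z₁ z₂ z₁ n1 n2 n1
      (fun v => -(φ (dotp v z₁)) ^ 2) (-(2 * c₀)) (((hm.comp (measurable_dotp z₁)).pow_const 2).neg) ?_ ?_)
    · intro V hV
      refine le_trans (mul_le_mul_of_nonneg_right ?_ hp0) hV
      linarith
    · intro v
      have := prod_bd K1 (bd_phi h (dotp v z₁)) (bd_phi h (dotp v z₁))
      rw [← sq] at this
      rw [abs_neg]
      refine bnd (4 * K ^ 2) (by linarith [pow_pos K0 3]) (by positivity) (this.trans ?_)
      refine mul_le_mul_of_nonneg_left ?_ (by positivity)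
      nlinarith [sq_nonneg (dotp v z₂)]
    · rw [integral_neg, gv_integral_comp hd z₁ n1 (f := fun x => φ x ^ 2) (by fun_prop)]
      linarith
  -- A
  have SA : ∀ u ∈ N, (gaussianMatrix p d) {V | 2 * p ≤ ∑ k, (dotp (V k) u) ^ 2} ≤ r := by
    intro u hu
    refine tst u hu (fun v => (dotp v u) ^ 2) 1 2 ?_ ?_ ?_ (by linarith)
    · exact (measurable_dotp u).pow_const 2
    · intro v
      rw [abs_of_nonneg (by positivity)]
      exact bnd 1 (by linarith) (by positivity)
        (by nlinarith [sq_nonneg (dotp v z₁), sq_nonneg (dotp v z₂)])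
    · rw [gv_sq, dotp_self_eq (hN u hu), div_self (by positivity)]
  have SB : ∀ u ∈ N, (gaussianMatrix p d)
      {V | δ ^ 2 * p ≤ ∑ k, (max (|dotp (V k) u| - M) 0) ^ 2} ≤ r := by
    intro u hu
    have hmd := measurable_dotp u
    refine tst u hu (fun v => (max (|dotp v u| - M) 0) ^ 2) (δ ^ 2 / 2) (δ ^ 2) ?_ ?_ ?_
      (by linarith)
    · have : Continuous fun x : ℝ => (max (|x| - M) 0) ^ 2 := by fun_prop
      exact this.measurable.comp hmd
    · intro v
      rw [abs_of_nonneg (by positivity)]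
      refine bnd 1 (by linarith) (by positivity) ?_
      have : (max (|dotp v u| - M) 0) ^ 2 ≤ |dotp v u| ^ 2 := by
        apply pow_le_pow_left₀ (le_max_right _ _)
        exact max_le (by linarith) (abs_nonneg _)
      rw [sq_abs] at this
      nlinarith [sq_nonneg (dotp v z₁), sq_nonneg (dotp v z₂)]
    · have : Continuous fun x : ℝ => (max (|x| - M) 0) ^ 2 := by fun_prop
      rw [gv_integral_comp hd u (hN u hu) (f := fun x => (max (|x| - M) 0) ^ 2) this.measurable]
      exact hM
  have SD : ∀ u ∈ N, (gaussianMatrix p d)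
      {V | (-c₁) * p ≤ ∑ k, -(deriv φ (dotp (V k) z₁) * dotp (V k) u) ^ 2} ≤ r := by
    intro u hu
    have hmd := measurable_dotp u
    have hmd1 := measurable_dotp z₁
    refine tst u hu (fun v => -(deriv φ (dotp v z₁) * dotp v u) ^ 2) (-(2 * c₁)) (-c₁) ?_ ?_ ?_
      (by linarith)
    · fun_prop
    · intro v
      rw [abs_neg, abs_of_nonneg (by positivity), mul_pow]
      refine bnd (K ^ 2) (by linarith [pow_pos K0 3]) (by positivity) ?_
      have : deriv φ (dotp v z₁) ^ 2 ≤ K ^ 2 := by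
        rw [← sq_abs]; exact pow_le_pow_left₀ (abs_nonneg _) ((h.bd _).trans KL') 2
      refine mul_le_mul this ?_ (by positivity) (by positivity)
      nlinarith [sq_nonneg (dotp v z₁), sq_nonneg (dotp v z₂)]
    · rw [integral_neg]
      linarith [exp_D hd h n1 (hN u hu) hD1 hD2]
  have bE : ∀ u v, |φ (dotp v z₁) * (deriv φ (dotp v z₁) * dotp v u)| ≤
      8 * K ^ 3 * (1 + (dotp v z₁) ^ 2 + (dotp v z₂) ^ 2 + (dotp v u) ^ 2) := by
    intro u v
    have := prod_bd (A := φ (dotp v z₁)) (B := dotp v u) (y := dotp v u) K1 (bd_phi h (dotp v z₁))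
      (by nlinarith [abs_nonneg (dotp v u)])
    have e : φ (dotp v z₁) * (deriv φ (dotp v z₁) * dotp v u) =
      deriv φ (dotp v z₁) * (φ (dotp v z₁) * dotp v u) := by ring
    rw [e, abs_mul]
    refine bnd (4 * K ^ 3) (by linarith) (by positivity) ?_
    refine (mul_le_mul ((h.bd _).trans KL') this (abs_nonneg _) K0.le).trans ?_
    have : 0 ≤ K ^ 3 * (dotp v z₂) ^ 2 := by positivity
    nlinarith
  have bF : ∀ u v, |(φ (dotp v z₂) - hermiteCoeff φ 1 * dotp v z₂) *
      (deriv φ (dotp v z₁) * dotp v u)| ≤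
      8 * K ^ 3 * (1 + (dotp v z₁) ^ 2 + (dotp v z₂) ^ 2 + (dotp v u) ^ 2) := by
    intro u v
    have := prod_bd (A := φ (dotp v z₂) - hermiteCoeff φ 1 * dotp v z₂) (B := dotp v u)
      (y := dotp v u) K1 (bd_tphi h (dotp v z₂)) (by nlinarith [abs_nonneg (dotp v u)])
    have e : (φ (dotp v z₂) - hermiteCoeff φ 1 * dotp v z₂) * (deriv φ (dotp v z₁) * dotp v u) =
      deriv φ (dotp v z₁) * ((φ (dotp v z₂) - hermiteCoeff φ 1 * dotp v z₂) * dotp v u) := by ring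
    rw [e, abs_mul]
    refine bnd (4 * K ^ 3) (by linarith) (by positivity) ?_
    refine (mul_le_mul ((h.bd _).trans KL') this (abs_nonneg _) K0.le).trans ?_
    have : 0 ≤ K ^ 3 * (dotp v z₁) ^ 2 := by positivity
    nlinarith
  have mE : ∀ u, Measurable fun v => φ (dotp v z₁) * (deriv φ (dotp v z₁) * dotp v u) := by
    intro u
    have hmd := measurable_dotp u
    have hmd1 := measurable_dotp z₁
    fun_prop
  have mF : ∀ u, Measurable fun v => (φ (dotp v z₂) - hermiteCoeff φ 1 * dotp v z₂) *
      (deriv φ (dotp v z₁) * dotp v u) := by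
    intro u
    have hmd := measurable_dotp u
    have hmd1 := measurable_dotp z₁
    have hmd2 := measurable_dotp z₂
    fun_prop
  have SE1 : ∀ u ∈ N, (gaussianMatrix p d)
      {V | (kap φ * (dotp z₁ u / d) + δ) * p ≤
        ∑ k, φ (dotp (V k) z₁) * (deriv φ (dotp (V k) z₁) * dotp (V k) u)} ≤ r := fun u hu =>
    tst u hu (fun v => φ (dotp v z₁) * (deriv φ (dotp v z₁) * dotp v u))
      (kap φ * (dotp z₁ u / d)) _ (mE u) (bE u) (exp_E hd h n1).le (by linarith)
  have SE2 : ∀ u ∈ N, (gaussianMatrix p d)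
      {V | (-(kap φ * (dotp z₁ u / d)) + δ) * p ≤
        ∑ k, -(φ (dotp (V k) z₁) * (deriv φ (dotp (V k) z₁) * dotp (V k) u))} ≤ r := fun u hu =>
    tst u hu (fun v => -(φ (dotp v z₁) * (deriv φ (dotp v z₁) * dotp v u)))
      (-(kap φ * (dotp z₁ u / d))) _ (mE u).neg (fun v => by rw [abs_neg]; exact bE u v)
      (by rw [integral_neg, exp_E hd h n1]) (by linarith)
  have SF1 : ∀ u ∈ N, (gaussianMatrix p d)
      {V | δ * p ≤ ∑ k, (φ (dotp (V k) z₂) - hermiteCoeff φ 1 * dotp (V k) z₂) *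
        (deriv φ (dotp (V k) z₁) * dotp (V k) u)} ≤ r := fun u hu =>
    tst u hu (fun v => (φ (dotp v z₂) - hermiteCoeff φ 1 * dotp v z₂) *
      (deriv φ (dotp v z₁) * dotp v u)) 0 _ (mF u) (bF u) (exp_F hd h h0 n1 n2 h12).le
      (by linarith)
  have SF2 : ∀ u ∈ N, (gaussianMatrix p d)
      {V | δ * p ≤ ∑ k, -((φ (dotp (V k) z₂) - hermiteCoeff φ 1 * dotp (V k) z₂) *
        (deriv φ (dotp (V k) z₁) * dotp (V k) u))} ≤ r := fun u hu =>
    tst u hu (fun v => -((φ (dotp v z₂) - hermiteCoeff φ 1 * dotp v z₂) *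
      (deriv φ (dotp v z₁) * dotp v u))) 0 _ (mF u).neg (fun v => by rw [abs_neg]; exact bF u v)
      (by rw [integral_neg, exp_F hd h h0 n1 n2 h12, neg_zero]) (by linarith)
  set T : (Fin d → ℝ) → Set (Fin p → Fin d → ℝ) := fun u =>
    {V | 2 * p ≤ ∑ k, (dotp (V k) u) ^ 2} ∪
    ({V | δ ^ 2 * p ≤ ∑ k, (max (|dotp (V k) u| - M) 0) ^ 2} ∪
    ({V | (-c₁) * p ≤ ∑ k, -(deriv φ (dotp (V k) z₁) * dotp (V k) u) ^ 2} ∪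
    ({V | (kap φ * (dotp z₁ u / d) + δ) * p ≤
        ∑ k, φ (dotp (V k) z₁) * (deriv φ (dotp (V k) z₁) * dotp (V k) u)} ∪
    ({V | (-(kap φ * (dotp z₁ u / d)) + δ) * p ≤
        ∑ k, -(φ (dotp (V k) z₁) * (deriv φ (dotp (V k) z₁) * dotp (V k) u))} ∪
    ({V | δ * p ≤ ∑ k, (φ (dotp (V k) z₂) - hermiteCoeff φ 1 * dotp (V k) z₂) *
        (deriv φ (dotp (V k) z₁) * dotp (V k) u)} ∪
    {V | δ * p ≤ ∑ k, -((φ (dotp (V k) z₂) - hermiteCoeff φ 1 * dotp (V k) z₂) *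
        (deriv φ (dotp (V k) z₁) * dotp (V k) u))}))))) with hT
  have hTu : ∀ u ∈ N, (gaussianMatrix p d) (T u) ≤ 7 * r := by
    intro u hu
    have e : (7 : ENNReal) * r = r + (r + (r + (r + (r + (r + r))))) := by ring
    rw [e]
    refine (measure_union_le _ _).trans (add_le_add (SA u hu) ?_)
    refine (measure_union_le _ _).trans (add_le_add (SB u hu) ?_)
    refine (measure_union_le _ _).trans (add_le_add (SD u hu) ?_)
    refine (measure_union_le _ _).trans (add_le_add (SE1 u hu) ?_)
    refine (measure_union_le _ _).trans (add_le_add (SE2 u hu) ?_)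
    exact (measure_union_le _ _).trans (add_le_add (SF1 u hu) (SF2 u hu))
  have hsub : {V | ¬ NetGood φ V z₁ z₂ N M δ c₀ c₁ (kap φ)} ⊆
      {V | (-c₀) * p ≤ ∑ k, -(φ (dotp (V k) z₁)) ^ 2} ∪ ⋃ u ∈ N, T u := by
    intro V hV
    by_contra hcon
    apply hV
    simp only [Set.mem_union, Set.mem_iUnion, not_or, not_exists, Set.mem_setOf_eq, not_le, hT,
      Finset.sum_neg_distrib] at hcon
    obtain ⟨g0, g⟩ := hcon
    refine ⟨fun u hu => ?_, fun u hu => ?_, ?_, fun u hu => ?_, fun u hu => ?_, fun u hu => ?_⟩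
    · rw [eNorm_sq]; exact (g u hu).1.le
    · rw [eNorm_sq]; exact (g u hu).2.1.le
    · rw [eNorm_sq]; simp only [featureMap]; linarith
    · rw [eNorm_sq]; simp only [gf]; linarith [(g u hu).2.2.1]
    · have a1 := (g u hu).2.2.2.1
      have a2 := (g u hu).2.2.2.2.1
      rw [abs_le]
      unfold dotp at a1 a2 ⊢
      simp only [featureMap, gf]
      unfold dotp
      constructor <;> nlinarith
    · have a1 := (g u hu).2.2.2.2.2.1
      have a2 := (g u hu).2.2.2.2.2.2
      rw [abs_le]
      unfold dotp at a1 a2 ⊢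
      simp only [tfeatureMap, gf]
      unfold dotp
      constructor <;> linarith
  refine (measure_mono hsub).trans ((measure_union_le _ _).trans ?_)
  have h1 : (gaussianMatrix p d) (⋃ u ∈ N, T u) ≤ N.card * (7 * r) := by
    refine (measure_biUnion_finset_le N T).trans ((Finset.sum_le_sum hTu).trans ?_)
    rw [Finset.sum_const, nsmul_eq_mul]
  refine (add_le_add SC h1).trans (le_of_eq ?_)
  rw [ENNReal.ofReal_mul (by positivity), ENNReal.ofReal_add (by positivity) (by norm_num),
    ENNReal.ofReal_mul (by norm_num)]
  simp only [ENNReal.ofReal_one, ENNReal.ofReal_natCast, ENNReal.ofReal_ofNat, ← hr]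
  ring


/-! ## Part 8: the data -/

/-- Orthogonalization of `x` against `y`. -/
def orth {d : ℕ} (x y : Fin d → ℝ) : Fin d → ℝ :=
  (Real.sqrt d / eNorm (x - (dotp x y / d) • y)) • (x - (dotp x y / d) • y)

lemma orth_spec {d : ℕ} (hd : 0 < d) {x y : Fin d → ℝ} (hx : eNorm x = Real.sqrt d)
    (hy : eNorm y = Real.sqrt d) {ρ : ℝ} (hρ : ρ ≤ 1 / 2) (h : |dotp x y| ≤ ρ * d) :
    eNorm (orth x y) = Real.sqrt d ∧ dotp (orth x y) y = 0 ∧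
      eNorm (orth x y - x) ≤ 2 * ρ * Real.sqrt d := by
  have hd' : (0 : ℝ) < d := by exact_mod_cast hd
  have hs : 0 < Real.sqrt d := Real.sqrt_pos.2 hd'
  set s := Real.sqrt d with hsd
  set w := x - (dotp x y / d) • y with hw
  have h1 : eNorm (w - x) ≤ ρ * s := by
    have e : w - x = -((dotp x y / d) • y) := by rw [hw]; abel
    rw [e, eNorm_neg, eNorm_smul, hy, abs_div, abs_of_pos hd']
    refine mul_le_mul_of_nonneg_right ?_ hs.le
    rw [div_le_iff₀ hd']; exact h
  have h2 : eNorm x ≤ eNorm w + eNorm (w - x) := by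
    have := eNorm_sub_le w (w - x)
    rwa [sub_sub_cancel] at this
  have h3 : eNorm w ≤ eNorm x + eNorm (w - x) := by
    have := eNorm_add_le x (w - x)
    rwa [add_sub_cancel] at this
  have hwpos : 0 < eNorm w := by
    rw [hx] at h2
    nlinarith
  have eo : orth x y = (s / eNorm w) • w := rfl
  have hyy : dotp y y = d := dotp_self_eq hy
  refine ⟨?_, ?_, ?_⟩
  · rw [eo, eNorm_smul, abs_of_nonneg (by positivity)]; field_simp
  · rw [eo, smul_dotp, hw, sub_dotp, smul_dotp, hyy]; field_simp; ring
  · have e2 : orth x y - x = (s / eNorm w - 1) • w + (w - x) := by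
      rw [eo, sub_smul, one_smul]; abel
    have e3 : eNorm ((s / eNorm w - 1) • w) = |s - eNorm w| := by
      rw [eNorm_smul]
      conv_lhs => rw [← abs_of_pos hwpos, ← abs_mul]
      congr 1
      rw [abs_of_pos hwpos]
      field_simp
    rw [e2]
    refine (eNorm_add_le _ _).trans ?_
    have : |s - eNorm w| ≤ ρ * s := by
      rw [hx] at h2 h3
      rw [abs_le]; constructor <;> linarith
    rw [e3]; linarith

lemma subg_bound {d : ℕ} {P : Measure (Fin d → ℝ)} {K : ℝ} (h : DataAssumption P K)
    {u : Fin d → ℝ} (hu : eNorm u = 1) :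
    Integrable (fun x => Real.exp ((dotp u x) ^ 2 / (|K| + 1) ^ 2)) P ∧
    ∫ x, Real.exp ((dotp u x) ^ 2 / (|K| + 1) ^ 2) ∂P ≤ 2 := by
  have := h.prob
  have hms : ∀ (w : Fin d → ℝ) (t : ℝ), Measurable fun x => Real.exp ((dotp w x) ^ 2 / t ^ 2) := by
    intro w t
    simp_rw [dotp_comm w]
    have := measurable_dotp w
    fun_prop
  have hbd : ∀ (w : Fin d → ℝ), eNorm w = 1 → ∀ t : ℝ, ∀ᵐ x ∂P,
      Real.exp ((dotp w x) ^ 2 / t ^ 2) ≤ Real.exp (d / t ^ 2) := by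
    intro w hw t
    filter_upwards [h.norm_eq] with x hx
    refine Real.exp_le_exp.2 (div_le_div_of_nonneg_right ?_ (sq_nonneg t))
    have h1 := abs_dotp_le w x
    rw [hw, hx, one_mul] at h1
    rw [← sq_abs]
    calc |dotp w x| ^ 2 ≤ Real.sqrt d ^ 2 := pow_le_pow_left₀ (abs_nonneg _) h1 2
      _ = d := Real.sq_sqrt (by positivity)
  have hInt : ∀ (w : Fin d → ℝ), eNorm w = 1 → ∀ t : ℝ,
      Integrable (fun x => Real.exp ((dotp w x) ^ 2 / t ^ 2)) P := by
    intro w hw t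
    refine Integrable.mono' (integrable_const (Real.exp (d / t ^ 2)))
      (hms w t).aestronglyMeasurable ?_
    filter_upwards [hbd w hw t] with x hx
    rw [Real.norm_eq_abs, abs_of_pos (Real.exp_pos _)]; exact hx
  refine ⟨hInt u hu _, ?_⟩
  set S : (Fin d → ℝ) → Set ℝ := fun w =>
    {t : ℝ | 0 < t ∧ ∫ x, Real.exp ((dotp w x) ^ 2 / t ^ 2) ∂P ≤ 2} with hS
  set T := Real.sqrt (2 * d) + 1 with hT
  have hmem : ∀ w : Fin d → ℝ, eNorm w = 1 → T ∈ S w := by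
    intro w hw
    have hT0 : 0 < T := by positivity
    refine ⟨hT0, ?_⟩
    refine (integral_mono_ae (hInt w hw T) (integrable_const _) (hbd w hw T)).trans ?_
    rw [integral_const, probReal_univ, one_smul]
    have h1 : (d : ℝ) / T ^ 2 ≤ 1 / 2 := by
      rw [div_le_iff₀ (by positivity)]
      have : Real.sqrt (2 * d) ^ 2 = 2 * d := Real.sq_sqrt (by positivity)
      have : 0 ≤ Real.sqrt (2 * d) := Real.sqrt_nonneg _
      rw [hT]; nlinarith
    have h2 : Real.exp ((1 : ℝ) / 2) ≤ 2 := by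
      have h3 : Real.exp ((1 : ℝ) / 2) ^ 2 ≤ 2 ^ 2 := by
        rw [← Real.exp_nat_mul]
        have := Real.exp_one_lt_d9
        norm_num
        linarith
      exact le_of_sq_le_sq h3 (by norm_num)
    exact (Real.exp_le_exp.2 h1).trans h2
  have hbdd : BddAbove (Set.range fun w : {w : Fin d → ℝ // eNorm w = 1} => sInf (S w.1)) := by
    refine ⟨T, ?_⟩
    rintro _ ⟨w, rfl⟩
    exact csInf_le ⟨0, fun t ht => ht.1.le⟩ (hmem w.1 w.2)
  have hle : sInf (S u) ≤ K := (le_ciSup hbdd ⟨u, hu⟩).trans h.subg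
  have hlt : sInf (S u) < |K| + 1 := by linarith [le_abs_self K]
  obtain ⟨t, ht, htl⟩ := exists_lt_of_csInf_lt ⟨T, hmem u hu⟩ hlt
  refine (integral_mono (hInt u hu _) (hInt u hu t) fun x => ?_).trans ht.2
  refine Real.exp_le_exp.2 (div_le_div_of_nonneg_left (sq_nonneg _) (pow_pos ht.1 2) ?_)
  exact pow_le_pow_left₀ ht.1.le htl.le 2

lemma continuous_dotp2 {d : ℕ} : Continuous fun x : (Fin d → ℝ) × (Fin d → ℝ) => dotp x.1 x.2 := by
  unfold dotp; fun_prop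

lemma data_conc {d : ℕ} (hd : 0 < d) {P : Measure (Fin d → ℝ)} {K : ℝ} (h : DataAssumption P K)
    {ρ : ℝ} (hρ : 0 < ρ) :
    (Measure.pi fun _ : Fin 2 => P) {x | ρ * d < |dotp (x 0) (x 1)|} ≤
      ENNReal.ofReal (2 * Real.exp (-(ρ ^ 2 / (|K| + 1) ^ 2) * d)) := by
  have := h.prob
  have hd' : (0 : ℝ) < d := by exact_mod_cast hd
  have hs : 0 < Real.sqrt d := Real.sqrt_pos.2 hd'
  have hmsb : MeasurableSet {y : (Fin d → ℝ) × (Fin d → ℝ) | ρ * d < |dotp y.1 y.2|} :=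
    measurableSet_lt measurable_const (continuous_dotp2.abs).measurable
  have hmp := measurePreserving_finTwoArrow P
  have e : {x : Fin 2 → Fin d → ℝ | ρ * d < |dotp (x 0) (x 1)|} =
      MeasurableEquiv.finTwoArrow ⁻¹' {y : (Fin d → ℝ) × (Fin d → ℝ) | ρ * d < |dotp y.1 y.2|} := by
    ext x; simp [MeasurableEquiv.finTwoArrow]
  rw [e, hmp.measure_preimage hmsb.nullMeasurableSet, Measure.prod_apply hmsb]
  set R := ENNReal.ofReal (2 * Real.exp (-(ρ ^ 2 / (|K| + 1) ^ 2) * d)) with hR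
  have key : ∀ᵐ x ∂P, P (Prod.mk x ⁻¹' {y : (Fin d → ℝ) × (Fin d → ℝ) | ρ * d < |dotp y.1 y.2|})
      ≤ R := by
    filter_upwards [h.norm_eq] with x hx
    set u := (Real.sqrt d)⁻¹ • x with hu
    have hun : eNorm u = 1 := by
      rw [hu, eNorm_smul, abs_of_pos (by positivity), hx]; field_simp
    obtain ⟨hi, hb⟩ := subg_bound h hun
    have hmk := mul_meas_ge_le_integral_of_nonneg
      (Eventually.of_forall fun x => (Real.exp_pos _).le) hi (Real.exp (ρ ^ 2 * d / (|K| + 1) ^ 2))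
    have hreal : P.real {y | Real.exp (ρ ^ 2 * d / (|K| + 1) ^ 2) ≤
        Real.exp ((dotp u y) ^ 2 / (|K| + 1) ^ 2)} ≤
        2 * Real.exp (-(ρ ^ 2 / (|K| + 1) ^ 2) * d) := by
      have e1 : Real.exp (-(ρ ^ 2 / (|K| + 1) ^ 2) * d) =
          (Real.exp (ρ ^ 2 * d / (|K| + 1) ^ 2))⁻¹ := by
        rw [← Real.exp_neg]; congr 1; ring
      rw [e1, ← div_eq_mul_inv, le_div_iff₀ (Real.exp_pos _), mul_comm]
      exact hmk.trans hb
    have hsub : (Prod.mk x ⁻¹' {y : (Fin d → ℝ) × (Fin d → ℝ) | ρ * d < |dotp y.1 y.2|}) ⊆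
        {y | Real.exp (ρ ^ 2 * d / (|K| + 1) ^ 2) ≤
          Real.exp ((dotp u y) ^ 2 / (|K| + 1) ^ 2)} := by
      intro y hy
      have hy' : ρ * d < |dotp x y| := hy
      refine Real.exp_le_exp.2 (div_le_div_of_nonneg_right ?_ (sq_nonneg _))
      have e2 : (dotp u y) ^ 2 = |dotp x y| ^ 2 / d := by
        rw [hu, smul_dotp, mul_pow, inv_pow, Real.sq_sqrt hd'.le, sq_abs]; field_simp
      rw [e2, le_div_iff₀ hd']
      calc ρ ^ 2 * d * d = (ρ * d) ^ 2 := by ring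
        _ ≤ _ := pow_le_pow_left₀ (by positivity) hy'.le 2
    refine (measure_mono hsub).trans ?_
    rw [← ENNReal.ofReal_toReal (measure_ne_top P _)]
    exact ENNReal.ofReal_le_ofReal hreal
  refine (lintegral_mono_ae key).trans ?_
  simp

lemma measurable_eNorm {m : ℕ} : Measurable fun x : Fin m → ℝ => eNorm x := by
  unfold eNorm
  exact (by fun_prop : Continuous fun x : Fin m → ℝ => Real.sqrt (∑ j, (x j) ^ 2)).measurable

lemma measurable_orth {d : ℕ} :
    Measurable fun x : Fin 2 → Fin d → ℝ => orth (x 0) (x 1) := by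
  have h1 : Measurable fun x : Fin 2 → Fin d → ℝ => x 0 := measurable_pi_apply 0
  have h2 : Measurable fun x : Fin 2 → Fin d → ℝ => x 1 := measurable_pi_apply 1
  have h3 : Measurable fun x : Fin 2 → Fin d → ℝ => dotp (x 0) (x 1) :=
    continuous_dotp2.measurable.comp (h1.prodMk h2)
  have h4 : Measurable fun x : Fin 2 → Fin d → ℝ => x 0 - (dotp (x 0) (x 1) / d) • x 1 :=
    h1.sub ((h3.div_const _).smul h2)
  exact ((measurable_const.div (measurable_eNorm.comp h4))).smul h4

set_option maxHeartbeats 1000000 in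
lemma measurable_netGood {p d : ℕ} {φ : ℝ → ℝ} {L : ℝ} (h : Smooth φ L)
    (N : Finset (Fin d → ℝ)) (M δ c₀ c₁ κ : ℝ) :
    MeasurableSet {ω : (Fin p → Fin d → ℝ) × (Fin 2 → Fin d → ℝ) |
      NetGood φ ω.1 (orth (ω.2 0) (ω.2 1)) (ω.2 1) N M δ c₀ c₁ κ} := by
  have hdm := h.dcont.measurable
  have hm := h.cont.measurable
  have hV : ∀ k, Measurable fun ω : (Fin p → Fin d → ℝ) × (Fin 2 → Fin d → ℝ) => ω.1 k :=
    fun k => (measurable_pi_apply k).comp measurable_fst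
  have hz2 : Measurable fun ω : (Fin p → Fin d → ℝ) × (Fin 2 → Fin d → ℝ) => ω.2 1 :=
    (measurable_pi_apply 1).comp measurable_snd
  have hz1 : Measurable fun ω : (Fin p → Fin d → ℝ) × (Fin 2 → Fin d → ℝ) =>
    orth (ω.2 0) (ω.2 1) := measurable_orth.comp measurable_snd
  have mu : ∀ k u, Measurable fun ω : (Fin p → Fin d → ℝ) × (Fin 2 → Fin d → ℝ) =>
      dotp (ω.1 k) u := fun k u => (measurable_dotp u).comp (hV k)
  have m1 : ∀ k, Measurable fun ω : (Fin p → Fin d → ℝ) × (Fin 2 → Fin d → ℝ) =>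
      dotp (ω.1 k) (orth (ω.2 0) (ω.2 1)) := fun k =>
    continuous_dotp2.measurable.comp ((hV k).prodMk hz1)
  have m2 : ∀ k, Measurable fun ω : (Fin p → Fin d → ℝ) × (Fin 2 → Fin d → ℝ) =>
      dotp (ω.1 k) (ω.2 1) := fun k =>
    continuous_dotp2.measurable.comp ((hV k).prodMk hz2)
  have fA : ∀ u, Measurable fun ω : (Fin p → Fin d → ℝ) × (Fin 2 → Fin d → ℝ) =>
      lf ω.1 u := fun u => measurable_pi_lambda _ fun k => mu k u
  have fB : ∀ u, Measurable fun ω : (Fin p → Fin d → ℝ) × (Fin 2 → Fin d → ℝ) =>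
      (fun k => max (|lf ω.1 u k| - M) 0) := fun u => measurable_pi_lambda _ fun k => by
    have : Continuous fun x : ℝ => max (|x| - M) 0 := by fun_prop
    exact this.measurable.comp (mu k u)
  have fC : Measurable fun ω : (Fin p → Fin d → ℝ) × (Fin 2 → Fin d → ℝ) =>
      featureMap φ ω.1 (orth (ω.2 0) (ω.2 1)) := measurable_pi_lambda _ fun k => hm.comp (m1 k)
  have fD : ∀ u, Measurable fun ω : (Fin p → Fin d → ℝ) × (Fin 2 → Fin d → ℝ) =>
      gf φ ω.1 (orth (ω.2 0) (ω.2 1)) u := fun u => measurable_pi_lambda _ fun k =>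
    (hdm.comp (m1 k)).mul (mu k u)
  have fF : Measurable fun ω : (Fin p → Fin d → ℝ) × (Fin 2 → Fin d → ℝ) =>
      tfeatureMap φ ω.1 (ω.2 1) := measurable_pi_lambda _ fun k =>
    (hm.comp (m2 k)).sub ((m2 k).const_mul _)
  have habs : Measurable fun x : ℝ => |x| := continuous_abs.measurable
  have e : {ω : (Fin p → Fin d → ℝ) × (Fin 2 → Fin d → ℝ) |
      NetGood φ ω.1 (orth (ω.2 0) (ω.2 1)) (ω.2 1) N M δ c₀ c₁ κ} =
      (⋂ u ∈ N, {ω | eNorm (lf ω.1 u) ^ 2 ≤ 2 * p}) ∩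
      ((⋂ u ∈ N, {ω | eNorm (fun k => max (|lf ω.1 u k| - M) 0) ^ 2 ≤ δ ^ 2 * p}) ∩
      ({ω | c₀ * p ≤ eNorm (featureMap φ ω.1 (orth (ω.2 0) (ω.2 1))) ^ 2} ∩
      ((⋂ u ∈ N, {ω | c₁ * p ≤ eNorm (gf φ ω.1 (orth (ω.2 0) (ω.2 1)) u) ^ 2}) ∩
      ((⋂ u ∈ N, {ω | |dotp (featureMap φ ω.1 (orth (ω.2 0) (ω.2 1)))
        (gf φ ω.1 (orth (ω.2 0) (ω.2 1)) u) - κ * p * (dotp (orth (ω.2 0) (ω.2 1)) u / d)|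
          ≤ δ * p}) ∩
      (⋂ u ∈ N, {ω | |dotp (tfeatureMap φ ω.1 (ω.2 1))
        (gf φ ω.1 (orth (ω.2 0) (ω.2 1)) u)| ≤ δ * p}))))) := by
    ext ω
    simp only [Set.mem_inter_iff, Set.mem_iInter]
    exact ⟨fun G => ⟨G.nA, G.nB, G.nC, G.nD, G.nE, G.nF⟩,
      fun G => ⟨G.1, G.2.1, G.2.2.1, G.2.2.2.1, G.2.2.2.2.1, G.2.2.2.2.2⟩⟩
  rw [e]
  refine MeasurableSet.inter (Finset.measurableSet_biInter _ fun u _ =>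
      measurableSet_le ((measurable_eNorm.comp (fA u)).pow_const 2) measurable_const)
    (MeasurableSet.inter (Finset.measurableSet_biInter _ fun u _ =>
      measurableSet_le ((measurable_eNorm.comp (fB u)).pow_const 2) measurable_const)
    (MeasurableSet.inter
      (measurableSet_le measurable_const ((measurable_eNorm.comp fC).pow_const 2))
    (MeasurableSet.inter (Finset.measurableSet_biInter _ fun u _ =>
      measurableSet_le measurable_const ((measurable_eNorm.comp (fD u)).pow_const 2))
    (MeasurableSet.inter (Finset.measurableSet_biInter _ fun u _ =>
      measurableSet_le (habs.comp ?_) measurable_const)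
    (Finset.measurableSet_biInter _ fun u _ =>
      measurableSet_le (habs.comp (continuous_dotp2.measurable.comp (fF.prodMk (fD u))))
        measurable_const)))))
  exact (continuous_dotp2.measurable.comp (fC.prodMk (fD u))).sub
    ((((measurable_dotp u).comp hz1).div_const _).const_mul _)


/-! ## Part 9: assembling -/

lemma prob_bad {p d : ℕ} (hd : 0 < d) {φ : ℝ → ℝ} {L : ℝ} (h : Smooth φ L)
    {P : Measure (Fin d → ℝ)} {K : ℝ} (hP : DataAssumption P K)
    (N : Finset (Fin d → ℝ)) {M δ c₀ c₁ κ ρ r : ℝ} (hρ0 : 0 < ρ) (hρ : ρ ≤ 1 / 2)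
    (hnet : ∀ (z₁ z₂ : Fin d → ℝ), eNorm z₁ = Real.sqrt d →
      eNorm z₂ = Real.sqrt d → dotp z₁ z₂ = 0 →
      (gaussianMatrix p d) {V | ¬ NetGood φ V z₁ z₂ N M δ c₀ c₁ κ} ≤ ENNReal.ofReal r) :
    ((gaussianMatrix p d).prod (Measure.pi fun _ : Fin 2 => P))
      {ω | ¬ (eNorm (ω.2 0) = Real.sqrt d ∧ eNorm (ω.2 1) = Real.sqrt d ∧
        |dotp (ω.2 0) (ω.2 1)| ≤ ρ * d ∧
        NetGood φ ω.1 (orth (ω.2 0) (ω.2 1)) (ω.2 1) N M δ c₀ c₁ κ)} ≤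
      ENNReal.ofReal (2 * Real.exp (-(ρ ^ 2 / (|K| + 1) ^ 2) * d)) + ENNReal.ofReal r := by
  have := hP.prob
  have hae : ∀ i : Fin 2, ∀ᵐ x ∂(Measure.pi fun _ : Fin 2 => P), eNorm (x i) = Real.sqrt d :=
    fun i => (measurePreserving_eval (fun _ : Fin 2 => P) i).quasiMeasurePreserving.ae hP.norm_eq
  have hnull : (Measure.pi fun _ : Fin 2 => P)
      {x | ¬ (eNorm (x 0) = Real.sqrt d ∧ eNorm (x 1) = Real.sqrt d)} = 0 :=
    ae_iff.1 ((hae 0).and (hae 1))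
  -- data part
  have hdat : MeasurableSet {x : Fin 2 → Fin d → ℝ | eNorm (x 0) = Real.sqrt d ∧
      eNorm (x 1) = Real.sqrt d ∧ |dotp (x 0) (x 1)| ≤ ρ * d} := by
    have h1 : Measurable fun x : Fin 2 → Fin d → ℝ => x 0 := measurable_pi_apply 0
    have h2 : Measurable fun x : Fin 2 → Fin d → ℝ => x 1 := measurable_pi_apply 1
    exact (measurableSet_eq_fun (measurable_eNorm.comp h1) measurable_const).inter
      ((measurableSet_eq_fun (measurable_eNorm.comp h2) measurable_const).inter
        (measurableSet_le (continuous_abs.measurable.comp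
          (continuous_dotp2.measurable.comp (h1.prodMk h2))) measurable_const))
  set DG : Set (Fin 2 → Fin d → ℝ) := {x | eNorm (x 0) = Real.sqrt d ∧
      eNorm (x 1) = Real.sqrt d ∧ |dotp (x 0) (x 1)| ≤ ρ * d} with hDG
  set NG : Set ((Fin p → Fin d → ℝ) × (Fin 2 → Fin d → ℝ)) :=
    {ω | NetGood φ ω.1 (orth (ω.2 0) (ω.2 1)) (ω.2 1) N M δ c₀ c₁ κ} with hNG
  have hNGm : MeasurableSet NG := measurable_netGood h N M δ c₀ c₁ κ
  have hDGm : (Measure.pi fun _ : Fin 2 => P) DGᶜ ≤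
      ENNReal.ofReal (2 * Real.exp (-(ρ ^ 2 / (|K| + 1) ^ 2) * d)) := by
    have hs : DGᶜ ⊆ {x | ¬ (eNorm (x 0) = Real.sqrt d ∧ eNorm (x 1) = Real.sqrt d)} ∪
        {x | ρ * d < |dotp (x 0) (x 1)|} := by
      intro x hx
      by_contra hc
      rw [Set.mem_union, not_or] at hc
      exact hx ⟨(not_not.1 hc.1).1, (not_not.1 hc.1).2, not_lt.1 hc.2⟩
    refine (measure_mono hs).trans ((measure_union_le _ _).trans ?_)
    rw [hnull, zero_add]
    exact data_conc hd hP hρ0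
  have hsub : {ω : (Fin p → Fin d → ℝ) × (Fin 2 → Fin d → ℝ) |
      ¬ (eNorm (ω.2 0) = Real.sqrt d ∧ eNorm (ω.2 1) = Real.sqrt d ∧
        |dotp (ω.2 0) (ω.2 1)| ≤ ρ * d ∧
        NetGood φ ω.1 (orth (ω.2 0) (ω.2 1)) (ω.2 1) N M δ c₀ c₁ κ)} ⊆
      (Prod.snd ⁻¹' DGᶜ) ∪ ((Prod.snd ⁻¹' DG) ∩ NGᶜ) := by
    intro ω hω
    by_cases hx : ω.2 ∈ DG
    · right
      exact ⟨hx, fun hn => hω ⟨hx.1, hx.2.1, hx.2.2, hn⟩⟩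
    · left; exact hx
  refine (measure_mono hsub).trans ((measure_union_le _ _).trans (add_le_add ?_ ?_))
  · have : MeasurePreserving Prod.snd ((gaussianMatrix p d).prod (Measure.pi fun _ : Fin 2 => P))
        (Measure.pi fun _ : Fin 2 => P) := measurePreserving_snd
    rw [this.measure_preimage hdat.compl.nullMeasurableSet]
    exact hDGm
  · rw [Measure.prod_apply_symm ((measurable_snd hdat).inter hNGm.compl)]
    have key : ∀ x : Fin 2 → Fin d → ℝ, (gaussianMatrix p d)
        ((fun V => (V, x)) ⁻¹' ((Prod.snd ⁻¹' DG) ∩ NGᶜ)) ≤ ENNReal.ofReal r := by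
      intro x
      by_cases hx : x ∈ DG
      · obtain ⟨o1, o2, _⟩ := orth_spec hd hx.1 hx.2.1 hρ hx.2.2
        refine le_trans (measure_mono ?_) (hnet (orth (x 0) (x 1)) (x 1) o1 hx.2.1 o2)
        intro V hV
        exact hV.2
      · have : ((fun V : Fin p → Fin d → ℝ => (V, x)) ⁻¹' ((Prod.snd ⁻¹' DG) ∩ NGᶜ)) = ∅ := by
          ext V
          simp [hx]
        rw [this, measure_empty]
        exact bot_le
    refine (lintegral_mono key).trans ?_
    simp

lemma asymp (p : ℕ → ℕ)
    (hp : Tendsto (fun d : ℕ => (p d : ℝ) / ((d : ℝ) * (Real.log d) ^ 2)) atTop atTop)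
    {a b R : ℝ} (ha : 0 < a) (hb : 0 < b) (hR : 1 ≤ R) :
    ∃ D : ℕ, ∀ d : ℕ, D ≤ d → 0 < d ∧ 0 < p d ∧ 2 * Real.exp (-a * d) +
      (7 * R ^ d + 1) * Real.exp (-b * p d) ≤ 2 * Real.exp (-1 * (Real.log d) ^ 2) := by
  set Q : ℝ := (1 + Real.log R + Real.log 8) / b with hQ
  have hlR : 0 ≤ Real.log R := Real.log_nonneg hR
  have hl8 : 0 < Real.log 8 := Real.log_pos (by norm_num)
  have hl2 : 0 < Real.log 2 := Real.log_pos (by norm_num)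
  have hQ0 : 0 < Q := by positivity
  have hlit : (fun x : ℝ => Real.log x ^ 2) =o[atTop] (fun x : ℝ => x) := by
    have := isLittleO_log_rpow_rpow_atTop (s := 1) 2 (by norm_num)
    simpa using this
  have e1 := (hlit.comp_tendsto tendsto_natCast_atTop_atTop).def (c := a / 2) (by positivity)
  have e2 : ∀ᶠ d : ℕ in atTop, Real.log 2 / (a / 2) ≤ (d : ℝ) :=
    tendsto_natCast_atTop_atTop.eventually_ge_atTop _
  have e3 := hp.eventually_ge_atTop Q
  have hall := (e1.and (e2.and (e3.and (eventually_ge_atTop 3))))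
  obtain ⟨D, hD⟩ := eventually_atTop.1 hall
  refine ⟨D, fun d hd => ?_⟩
  obtain ⟨f1, f2, f3, f4⟩ := hD d hd
  have hd1 : (3 : ℝ) ≤ d := by exact_mod_cast f4
  have hd0 : 0 < d := by omega
  have hlog1 : 1 ≤ Real.log d := by
    rw [Real.le_log_iff_exp_le (by linarith)]
    have := Real.exp_one_lt_d9
    linarith
  have hlogsq : 1 ≤ Real.log d ^ 2 := one_le_pow₀ hlog1
  simp only [Function.comp_apply, Real.norm_eq_abs] at f1
  rw [abs_of_nonneg (by positivity), abs_of_nonneg (by positivity)] at f1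
  rw [div_le_iff₀ (by positivity)] at f2
  rw [le_div_iff₀ (by positivity)] at f3
  have hpb : (1 + Real.log R + Real.log 8) * (d * Real.log d ^ 2) ≤ b * p d := by
    have := mul_le_mul_of_nonneg_left f3 hb.le
    rw [hQ] at this
    calc _ = b * ((1 + Real.log R + Real.log 8) / b * (d * Real.log d ^ 2)) := by field_simp
      _ ≤ _ := this
  have hpp : 0 < p d := by
    have : 0 < Q * (d * Real.log d ^ 2) := by positivity
    have : (0 : ℝ) < p d := by linarith
    exact_mod_cast this
  refine ⟨hd0, hpp, ?_⟩
  have t1 : 2 * Real.exp (-a * d) ≤ Real.exp (-1 * Real.log d ^ 2) := by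
    have : 2 * Real.exp (-a * d) = Real.exp (Real.log 2 + -a * d) := by
      rw [Real.exp_add, Real.exp_log (by norm_num)]
    rw [this]
    apply Real.exp_le_exp.2
    linarith
  have t2 : (7 * R ^ d + 1) * Real.exp (-b * p d) ≤ Real.exp (-1 * Real.log d ^ 2) := by
    have hRd : 1 ≤ R ^ d := one_le_pow₀ hR
    have h8 : 7 * R ^ d + 1 ≤ Real.exp (Real.log 8 + d * Real.log R) := by
      rw [Real.exp_add, Real.exp_log (by norm_num), Real.exp_nat_mul, Real.exp_log (by linarith)]
      linarith
    calc _ ≤ Real.exp (Real.log 8 + d * Real.log R) * Real.exp (-b * p d) :=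
          mul_le_mul_of_nonneg_right h8 (Real.exp_pos _).le
      _ ≤ _ := by
          rw [← Real.exp_add]
          apply Real.exp_le_exp.2
          have g1 : Real.log d ^ 2 ≤ d * Real.log d ^ 2 := by nlinarith
          have g2 : (d : ℝ) ≤ d * Real.log d ^ 2 := by nlinarith
          have g3 : 1 ≤ d * Real.log d ^ 2 := by linarith
          have g4 := mul_le_mul_of_nonneg_left g2 hlR
          have g5 := mul_le_mul_of_nonneg_left g3 hl8.le
          nlinarith
  linarith

lemma choose_consts {L κ C τ c₁ : ℝ} (hL : 0 < L) (hC : 0 ≤ C) (hτ : 0 < τ) (hc₁ : 0 < c₁) :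
    ∃ δ' δ θ : ℝ, 0 < δ' ∧ 0 < δ ∧ 0 < θ ∧ θ ≤ 1 / 2 ∧
      δ' + C * (L * (2 * δ')) ≤ τ / 2 ∧ L * 3 * (L * (2 * δ')) ≤ τ / 2 ∧
      δ + 3 * θ ≤ δ' ∧ 3 * L * θ ≤ Real.sqrt c₁ / 2 ∧ δ + |κ| * θ + C * (L * 3 * θ) ≤ δ' := by
  have hκ := abs_nonneg κ
  have hW : 0 < 1 + 2 * C * L + 6 * L ^ 2 := by positivity
  set δ' := τ / 2 / (1 + 2 * C * L + 6 * L ^ 2) with hδ'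
  have d0 : 0 < δ' := by positivity
  have d1 : δ' * (1 + 2 * C * L + 6 * L ^ 2) = τ / 2 := by rw [hδ']; field_simp
  have hU : 0 < 3 + |κ| + 3 * C * L := by positivity
  set θ := min (1 / 2) (min (Real.sqrt c₁ / (6 * L)) (δ' / 2 / (3 + |κ| + 3 * C * L))) with hθ
  have hsc : 0 < Real.sqrt c₁ := Real.sqrt_pos.2 hc₁
  have t0 : 0 < θ := lt_min (by norm_num) (lt_min (by positivity) (by positivity))
  have t1 : θ ≤ 1 / 2 := min_le_left _ _
  have t2 : θ * (6 * L) ≤ Real.sqrt c₁ :=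
    (le_div_iff₀ (by positivity)).1 ((min_le_right _ _).trans (min_le_left _ _))
  have t3 : θ * (3 + |κ| + 3 * C * L) ≤ δ' / 2 :=
    (le_div_iff₀ (by positivity)).1 ((min_le_right _ _).trans (min_le_right _ _))
  have q1 : 0 ≤ θ * |κ| := by positivity
  have q2 : 0 ≤ θ * (C * L) := by positivity
  have q3 : 0 ≤ δ' * (C * L) := by positivity
  have q4 : 0 ≤ δ' * L ^ 2 := by positivity
  refine ⟨δ', δ' / 2, θ, d0, by positivity, t0, t1, ?_, ?_, ?_, ?_, ?_⟩ <;> nlinarith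

lemma choose_e {L κ C τ M : ℝ} (hL : 0 < L) (hC : 0 ≤ C) (hτ : 0 < τ) (hM : 0 ≤ M) :
    ∃ e : ℝ, 0 < e ∧ C * L * 3 * e ≤ τ ∧ |κ| * e + C * (L * (2 * 3 * M * e)) ≤ τ / 2 ∧
      |κ| * e + L ^ 2 * 3 ^ 2 * e ≤ τ / 2 ∧ L * 3 * (L * (2 * 3 * M * e)) ≤ τ / 2 := by
  have hκ := abs_nonneg κ
  have hW : 0 < 1 + 3 * (C * L) + |κ| + 6 * (C * L * M) + 9 * L ^ 2 + 18 * (L ^ 2 * M) := by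
    positivity
  set e := τ / 2 / (1 + 3 * (C * L) + |κ| + 6 * (C * L * M) + 9 * L ^ 2 + 18 * (L ^ 2 * M)) with he
  have e0 : 0 < e := by positivity
  have e1 : e * (1 + 3 * (C * L) + |κ| + 6 * (C * L * M) + 9 * L ^ 2 + 18 * (L ^ 2 * M)) = τ / 2 := by
    rw [he]; field_simp
  have q1 : 0 ≤ e * (C * L) := by positivity
  have q2 : 0 ≤ e * |κ| := by positivity
  have q3 : 0 ≤ e * (C * L * M) := by positivity
  have q4 : 0 ≤ e * L ^ 2 := by positivity
  have q5 : 0 ≤ e * (L ^ 2 * M) := by positivity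
  refine ⟨e, e0, ?_, ?_, ?_, ?_⟩ <;> nlinarith


/-- **Lemma A.11 (Negligibility of the cross term in the contradiction equation).**
Under the random features setup with `n = 2` and the data, activation, and scaling
assumptions: for every `η > 0` there are constants `c, ε₀ > 0` and `D` such that for all
`d ≥ D`, with probability at least `1 − 2 exp(−c log² d)` over `V` and `(x₁, x₂)`,
simultaneously for all `a₁, a₂, ε₁, ε₂` with `‖x₁+ε₁‖₂ = ‖x₁+ε₂‖₂ = √d`,
`max(‖ε₁‖₂, ‖ε₂‖₂) ≤ ε₀ √d` and `φ(x₂) = a₁ φ(x₁+ε₁) + a₂ φ(x₁+ε₂)`: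
`|a₂ · φ̃(x₂)ᵀ(φ(x₁+ε₂) − φ(x₁+ε₁))| ≤ η p`. -/
theorem cross_term_negligibility
    (φ : ℝ → ℝ) (hφ : ActivationAssumptionCore φ)
    (K : ℝ)
    (p : ℕ → ℕ)
    (P : (d : ℕ) → Measure (Fin d → ℝ))
    (hdata : ∀ d, DataAssumption (P d) K)
    (hp : Tendsto (fun d : ℕ => (p d : ℝ) / ((d : ℝ) * (Real.log d) ^ 2)) atTop atTop) :
    ∀ η : ℝ, 0 < η → ∃ c : ℝ, 0 < c ∧ ∃ ε₀ : ℝ, 0 < ε₀ ∧ ∃ D : ℕ, ∀ d : ℕ, D ≤ d →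
      1 - ENNReal.ofReal (2 * Real.exp (-c * (Real.log d) ^ 2)) ≤
        ((gaussianMatrix (p d) d).prod (Measure.pi fun _ : Fin 2 => P d))
          {ω | ∀ a₁ a₂ : ℝ, ∀ ε₁ ε₂ : Fin d → ℝ,
            eNorm (ω.2 0 + ε₁) = Real.sqrt d → eNorm (ω.2 0 + ε₂) = Real.sqrt d →
            max (eNorm ε₁) (eNorm ε₂) ≤ ε₀ * Real.sqrt d →
            featureMap φ ω.1 (ω.2 1) =
              (fun k => a₁ * featureMap φ ω.1 (ω.2 0 + ε₁) k +
                a₂ * featureMap φ ω.1 (ω.2 0 + ε₂) k) →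
            |a₂ * dotp (tfeatureMap φ ω.1 (ω.2 1))
                (fun k => featureMap φ ω.1 (ω.2 0 + ε₂) k -
                  featureMap φ ω.1 (ω.2 0 + ε₁) k)| ≤ η * (p d)} := by
  intro η hη
  obtain ⟨L, h⟩ := Smooth.of_act hφ
  obtain ⟨k0, k1, k2⟩ := pos_consts h hφ.nonlinear
  set c₀ : ℝ := (∫ g, φ g ^ 2 ∂(gaussianReal 0 1)) / 2 with hc₀
  set c₁ : ℝ := min (∫ g, deriv φ g ^ 2 ∂(gaussianReal 0 1))
    (∫ g, deriv φ g ^ 2 * g ^ 2 ∂(gaussianReal 0 1)) / 2 with hc₁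
  have c₀pos : 0 < c₀ := by positivity
  have c₁pos : 0 < c₁ := half_pos (lt_min k1 k2)
  set C : ℝ := |φ 0| + L * 3 + |hermiteCoeff φ 1| * 3 with hC
  have hL := h.pos
  have C0 : 0 ≤ C := by positivity
  obtain ⟨τ, τ0, boot⟩ := scalar_bootstrap (c₁ := c₁ / 4) c₀pos (by positivity)
    (mul_nonneg C0 C0) hη
  obtain ⟨δ', δ, θ, δ'0, δ0, θ0, θ1, w1, w2, w3, w4, w5⟩ :=
    choose_consts (κ := kap φ) hL C0 τ0 c₁pos
  obtain ⟨M, M0, hM⟩ := exists_M (ε := δ ^ 2 / 2) (by positivity)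
  obtain ⟨e, e0, v1, v2, v3, v4⟩ := choose_e (κ := kap φ) hL C0 τ0 M0
  have hml := min_le_left (∫ g, deriv φ g ^ 2 ∂(gaussianReal 0 1))
    (∫ g, deriv φ g ^ 2 * g ^ 2 ∂(gaussianReal 0 1))
  have hmr := min_le_right (∫ g, deriv φ g ^ 2 ∂(gaussianReal 0 1))
    (∫ g, deriv φ g ^ 2 * g ^ 2 ∂(gaussianReal 0 1))
  obtain ⟨b, b0, hnet⟩ := netgood_prob h hφ.mu0 M0 δ0 c₀pos c₁pos hM
    (by rw [hc₀]; linarith) (by rw [hc₁]; linarith) (by rw [hc₁]; linarith)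
  set ρ : ℝ := min (1 / 2) (e / 4) with hρ
  have ρ0 : 0 < ρ := lt_min (by norm_num) (by positivity)
  have ρ1 : ρ ≤ 1 / 2 := min_le_left _ _
  have ρ2 : ρ ≤ e / 4 := min_le_right _ _
  obtain ⟨D, hD⟩ := asymp p hp (a := ρ ^ 2 / (|K| + 1) ^ 2) (b := b) (R := 1 + 2 / θ)
    (by positivity) b0 (by linarith [div_pos two_pos θ0])
  refine ⟨1, one_pos, e / 2, by positivity, D, ?_⟩
  intro d hd
  obtain ⟨d0, p0, hfin⟩ := hD d hd
  obtain ⟨N, N1, N2, N3⟩ := exists_net d d0 θ0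
  have hs : 0 < Real.sqrt d := Real.sqrt_pos.2 (by exact_mod_cast d0)
  have := (hdata d).prob
  have hbad := prob_bad (p := p d) d0 h (hdata d) N (M := M) (δ := δ) (c₀ := c₀) (c₁ := c₁)
    (κ := kap φ) (r := (7 * N.card + 1) * Real.exp (-b * p d)) ρ0 ρ1
    (fun z₁ z₂ n1 n2 h12 => hnet d (p d) d0 z₁ z₂ n1 n2 h12 N N1)
  set BAD : Set ((Fin (p d) → Fin d → ℝ) × (Fin 2 → Fin d → ℝ)) :=
    {ω | ¬ (eNorm (ω.2 0) = Real.sqrt d ∧ eNorm (ω.2 1) = Real.sqrt d ∧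
        |dotp (ω.2 0) (ω.2 1)| ≤ ρ * d ∧
        NetGood φ ω.1 (orth (ω.2 0) (ω.2 1)) (ω.2 1) N M δ c₀ c₁ (kap φ))} with hBAD
  have hbad2 : ((gaussianMatrix (p d) d).prod (Measure.pi fun _ : Fin 2 => P d)) BAD ≤
      ENNReal.ofReal (2 * Real.exp (-1 * (Real.log d) ^ 2)) := by
    refine hbad.trans ?_
    rw [← ENNReal.ofReal_add (by positivity) (by positivity)]
    refine ENNReal.ofReal_le_ofReal (le_trans ?_ hfin)
    refine add_le_add le_rfl (mul_le_mul_of_nonneg_right ?_ (Real.exp_pos _).le)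
    linarith
  rw [tsub_le_iff_right]
  refine le_trans ?_ (add_le_add le_rfl hbad2)
  refine le_trans ?_ (measure_union_le _ _)
  rw [← measure_univ (μ := (gaussianMatrix (p d) d).prod (Measure.pi fun _ : Fin 2 => P d))]
  refine measure_mono ?_
  intro ω _
  by_cases hω : ω ∈ BAD
  · exact Or.inr hω
  left
  obtain ⟨x1, x2, x12, G⟩ := not_not.1 hω
  intro a₁ a₂ ε₁ ε₂ hy1 hy2 hmax heq
  obtain ⟨o1, o2, o3⟩ := orth_spec d0 x1 x2 ρ1 x12
  have G' := G.good h d0 p0 o1 x2 N2 M0 δ0.le θ0 θ1 c₁pos hC.symm.le w3 w4 w5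
  have near : ∀ ε : Fin d → ℝ, eNorm ε ≤ e / 2 * Real.sqrt d →
      eNorm (ω.2 0 + ε - orth (ω.2 0) (ω.2 1)) ≤ e * Real.sqrt d := by
    intro ε hε
    have e1 : ω.2 0 + ε - orth (ω.2 0) (ω.2 1) = ε - (orth (ω.2 0) (ω.2 1) - ω.2 0) := by abel
    rw [e1]
    refine (eNorm_sub_le _ _).trans ?_
    have : 2 * ρ * Real.sqrt d ≤ e / 2 * Real.sqrt d :=
      mul_le_mul_of_nonneg_right (by linarith) hs.le
    linarith
  refine det_conclusion h G' (by norm_num) M0 δ'0.le e0.le p0 rfl hs o1 x2 hC.symm.le v1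
    ?_ ?_ ?_ boot hy1 hy2 (near _ ((le_max_left _ _).trans hmax))
    (near _ ((le_max_right _ _).trans hmax)) heq
  · have : C * (L * (2 * 3 * M * e + 2 * δ')) =
      C * (L * (2 * 3 * M * e)) + C * (L * (2 * δ')) := by ring
    linarith
  · have : 0 ≤ C * (L * (2 * δ')) := by positivity
    linarith
  · have : L * 3 * (L * (2 * 3 * M * e + 2 * δ')) =
      L * 3 * (L * (2 * 3 * M * e)) + L * 3 * (L * (2 * δ')) := by ring
    linarith
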